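/- arXiv:1510.09148 — 2 statements merged into one kernel-verified Lean document; each statement's English description precedes it below -/
import Mathlib

section
/- Let α > 0 and τ ∈ ℝ \ {0}. Then x · d/dx[ K_{α+iτ}(√x) I_{α−iτ}(√x) − K_{α−iτ}(√x) I_{α+iτ}(√x) ] → 0 as x → +∞. -/
/-- Modified Bessel function of the second kind (Macdonald function). -/
noncomputable def besselK (ν : ℂ) (x : ℝ) : ℂ :=
  ∫ t in Set.Ioi (0 : ℝ), Complex.exp (-(x : ℂ) * Real.cosh t) * Complex.cosh (ν * t)

/-- Modified Bessel function of the first kind. -/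
noncomputable def besselI (ν : ℂ) (x : ℝ) : ℂ :=
  ∑' k : ℕ, ((x : ℂ) / 2) ^ (ν + 2 * (k : ℂ)) / ((Nat.factorial k : ℂ) * Complex.Gamma (ν + (k : ℂ) + 1))

open Set MeasureTheory Filter Topology

lemma Real.one_add_sq_div_two_le_cosh {t : ℝ} (ht : 0 ≤ t) : 1 + t ^ 2 / 2 ≤ Real.cosh t := by
  have h : t / 2 ≤ Real.sinh (t / 2) := Real.self_le_sinh_iff.2 (by positivity)
  have h2 : Real.cosh t = 1 + 2 * Real.sinh (t / 2) ^ 2 := by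
    have := Real.cosh_two_mul (t / 2)
    rw [mul_div_cancel₀ t two_ne_zero, Real.cosh_sq] at this
    linarith
  have h3 : (t / 2) ^ 2 ≤ Real.sinh (t / 2) ^ 2 := by gcongr
  rw [h2]
  linarith

lemma Real.mul_exp_neg_mul_le {c : ℝ} (hc : 0 < c) (u : ℝ) :
    u * Real.exp (-(c * u)) ≤ 2 / c * Real.exp (-(c * u / 2)) := by
  have h : c * u / 2 ≤ Real.exp (c * u / 2) := by linarith [Real.add_one_le_exp (c * u / 2)]
  have h2 : Real.exp (-(c * u)) = Real.exp (-(c * u / 2)) * Real.exp (-(c * u / 2)) := by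
    rw [← Real.exp_add]
    congr 1
    ring
  have h3 : Real.exp (c * u / 2) * Real.exp (-(c * u / 2)) = 1 := by
    rw [← Real.exp_add]
    simp
  calc u * Real.exp (-(c * u))
      = 2 / c * (c * u / 2 * Real.exp (-(c * u / 2)) * Real.exp (-(c * u / 2))) := by
        rw [h2]
        field_simp
    _ ≤ 2 / c * (Real.exp (c * u / 2) * Real.exp (-(c * u / 2)) * Real.exp (-(c * u / 2))) := by
        gcongr
    _ = _ := by rw [h3, one_mul]

lemma Complex.norm_cosh_mul_ofReal_le (μ : ℂ) {t : ℝ} (ht : 0 ≤ t) :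
    ‖Complex.cosh (μ * t)‖ ≤ Real.exp (|μ.re| * t) := by
  have h1 : ‖Complex.exp (μ * t)‖ ≤ Real.exp (|μ.re| * t) := by
    rw [Complex.norm_exp]
    simp only [Complex.re_mul_ofReal]
    gcongr
    exact le_abs_self _
  have h2 : ‖Complex.exp (-(μ * t))‖ ≤ Real.exp (|μ.re| * t) := by
    rw [Complex.norm_exp]
    simp only [Complex.neg_re, Complex.re_mul_ofReal, ← neg_mul]
    gcongr
    exact neg_le_abs _
  rw [Complex.cosh, norm_div, Complex.norm_ofNat, div_le_iff₀ two_pos]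
  linarith [norm_add_le (Complex.exp (μ * t)) (Complex.exp (-(μ * t)))]

lemma integrableOn_exp_neg_mul_sq_add_mul {b : ℝ} (hb : 0 < b) (a : ℝ) :
    IntegrableOn (fun t : ℝ => Real.exp (-(b * t ^ 2) + a * t)) (Ioi 0) := by
  have h := (integrable_cexp_quadratic' (b := -(b : ℂ)) (by simpa using hb) a 0).norm
  refine (h.congr (ae_of_all _ fun t => ?_)).integrableOn
  simp only [Complex.norm_exp]
  congr 1
  simp [← Complex.ofReal_pow]

lemma exists_integral_exp_neg_mul_sq_add_mul_le {b a : ℝ} (hb : 0 < b) (ha : 0 ≤ a) :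
    ∃ A : ℝ, ∀ y : ℝ, 1 ≤ y →
      ∫ t in Ioi (0 : ℝ), Real.exp (-(b * y * t ^ 2) + a * t) ≤ A / √y := by
  refine ⟨∫ t in Ioi (0 : ℝ), Real.exp (-(b * t ^ 2) + a * t), fun y hy => ?_⟩
  have hy0 : 0 < y := by linarith
  have hs : 0 < √y := Real.sqrt_pos.2 hy0
  have hs1 : 1 ≤ √y := Real.one_le_sqrt.2 hy
  have h := integral_comp_mul_left_Ioi
    (fun t : ℝ => Real.exp (-(b * t ^ 2) + a * t)) 0 hs
  rw [mul_zero, smul_eq_mul, inv_mul_eq_div] at h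
  rw [← h]
  refine setIntegral_mono_on (integrableOn_exp_neg_mul_sq_add_mul (by positivity) a) ?_
    measurableSet_Ioi fun t ht => ?_
  · have := integrableOn_exp_neg_mul_sq_add_mul (b := b * y) (by positivity) (a * √y)
    refine this.congr_fun (fun t _ => ?_) measurableSet_Ioi
    simp only [mul_pow, Real.sq_sqrt hy0.le]
    ring_nf
  · have ht0 : (0 : ℝ) < t := ht
    simp only [mul_pow, Real.sq_sqrt hy0.le]
    rw [← mul_assoc]
    gcongr
    nlinarith

/-- The integral of `-cosh t` against the integrand of `besselK`. -/
noncomputable def besselKDeriv (ν : ℂ) (x : ℝ) : ℂ :=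
  ∫ t in Ioi (0 : ℝ),
    -(Real.cosh t : ℂ) * (Complex.exp (-(x : ℂ) * Real.cosh t) * Complex.cosh (ν * t))

lemma norm_besselK_integrand_le (ν : ℂ) (y : ℝ) {t : ℝ} (ht : 0 ≤ t) :
    ‖Complex.exp (-(y : ℂ) * Real.cosh t) * Complex.cosh (ν * t)‖ ≤
      Real.exp (-(y * Real.cosh t)) * Real.exp (|ν.re| * t) := by
  rw [norm_mul, Complex.norm_exp, ← Complex.ofReal_neg, ← Complex.ofReal_mul, Complex.ofReal_re,
    neg_mul]
  gcongr
  exact Complex.norm_cosh_mul_ofReal_le ν ht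

lemma norm_besselK_integrand_le_gaussian (ν : ℂ) {y : ℝ} (hy : 0 < y) {t : ℝ} (ht : 0 ≤ t) :
    ‖Complex.exp (-(y : ℂ) * Real.cosh t) * Complex.cosh (ν * t)‖ ≤
      Real.exp (-y) * Real.exp (-(1 / 2 * y * t ^ 2) + |ν.re| * t) := by
  refine (norm_besselK_integrand_le ν y ht).trans ?_
  rw [← Real.exp_add, ← Real.exp_add]
  apply Real.exp_le_exp.2
  nlinarith [Real.one_add_sq_div_two_le_cosh ht]

lemma norm_cosh_sub_one_mul_besselK_integrand_le (ν : ℂ) {y : ℝ} (hy : 0 < y) {t : ℝ}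
    (ht : 0 ≤ t) :
    ‖((1 - Real.cosh t : ℝ) : ℂ) *
        (Complex.exp (-(y : ℂ) * Real.cosh t) * Complex.cosh (ν * t))‖ ≤
      2 / y * Real.exp (-y) * Real.exp (-(1 / 4 * y * t ^ 2) + |ν.re| * t) := by
  have hu := Real.one_add_sq_div_two_le_cosh ht
  have hu' : 0 ≤ Real.cosh t - 1 := by linarith [Real.one_le_cosh t]
  rw [norm_mul, Complex.norm_real, Real.norm_eq_abs, abs_sub_comm, abs_of_nonneg hu']
  calc _ ≤ (Real.cosh t - 1) * (Real.exp (-(y * Real.cosh t)) * Real.exp (|ν.re| * t)) := by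
        gcongr
        exact norm_besselK_integrand_le ν y ht
    _ = (Real.cosh t - 1) * Real.exp (-(y * (Real.cosh t - 1))) *
          (Real.exp (-y) * Real.exp (|ν.re| * t)) := by
        rw [show -(y * Real.cosh t) = -(y * (Real.cosh t - 1)) + -y by ring, Real.exp_add]
        ring
    _ ≤ 2 / y * Real.exp (-(y * (Real.cosh t - 1) / 2)) *
          (Real.exp (-y) * Real.exp (|ν.re| * t)) := by
        gcongr ?_ * _
        exact Real.mul_exp_neg_mul_le hy _
    _ ≤ 2 / y * Real.exp (-(1 / 4 * y * t ^ 2)) *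
          (Real.exp (-y) * Real.exp (|ν.re| * t)) := by
        gcongr
        nlinarith
    _ = _ := by
        rw [Real.exp_add]
        ring

lemma integrableOn_besselK_integrand (ν : ℂ) {y : ℝ} (hy : 0 < y) :
    IntegrableOn (fun t : ℝ => Complex.exp (-(y : ℂ) * Real.cosh t) * Complex.cosh (ν * t))
      (Ioi 0) := by
  refine Integrable.mono' (g := fun t => Real.exp (-y) *
    Real.exp (-(1 / 2 * y * t ^ 2) + |ν.re| * t)) ?_ ?_ ?_
  · exact (integrableOn_exp_neg_mul_sq_add_mul (by positivity) _).const_mul _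
  · refine Continuous.aestronglyMeasurable ?_
    have := Complex.continuous_cosh
    have := Real.continuous_cosh
    fun_prop
  · exact (ae_restrict_mem measurableSet_Ioi).mono fun t ht =>
      norm_besselK_integrand_le_gaussian ν hy (le_of_lt ht)

lemma integrableOn_and_hasDerivAt_besselK (ν : ℂ) {y : ℝ} (hy : 0 < y) :
    IntegrableOn (fun t : ℝ => -(Real.cosh t : ℂ) *
      (Complex.exp (-(y : ℂ) * Real.cosh t) * Complex.cosh (ν * t))) (Ioi 0) ∧
    HasDerivAt (besselK ν) (besselKDeriv ν y) y := by
  have hc := Complex.continuous_cosh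
  have hc' := Real.continuous_cosh
  refine hasDerivAt_integral_of_dominated_loc_of_deriv_le (𝕜 := ℝ) (s := Ioi (y / 2))
    (F := fun (x t : ℝ) => Complex.exp (-(x : ℂ) * Real.cosh t) * Complex.cosh (ν * t))
    (F' := fun (x t : ℝ) => -(Real.cosh t : ℂ) *
      (Complex.exp (-(x : ℂ) * Real.cosh t) * Complex.cosh (ν * t)))
    (bound := fun t => 2 / (y / 2) * Real.exp (-(y / 8 * t ^ 2) + |ν.re| * t))
    (Ioi_mem_nhds (by linarith)) ?_ (integrableOn_besselK_integrand ν hy) ?_ ?_ ?_ ?_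
  · exact Eventually.of_forall fun x => Continuous.aestronglyMeasurable (by fun_prop)
  · exact Continuous.aestronglyMeasurable (by fun_prop)
  · refine (ae_restrict_mem measurableSet_Ioi).mono fun t ht x hx => ?_
    have ht0 : (0 : ℝ) ≤ t := le_of_lt ht
    have hx' : y / 2 < x := hx
    have hcosh := Real.one_add_sq_div_two_le_cosh ht0
    have hpos := Real.cosh_pos t
    rw [norm_mul, norm_neg, Complex.norm_real, Real.norm_eq_abs, abs_of_pos hpos]
    calc _ ≤ Real.cosh t * (Real.exp (-(x * Real.cosh t)) * Real.exp (|ν.re| * t)) := by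
          gcongr
          exact norm_besselK_integrand_le ν x ht0
      _ ≤ Real.cosh t * (Real.exp (-(y / 2 * Real.cosh t)) * Real.exp (|ν.re| * t)) := by
          gcongr
      _ = Real.cosh t * Real.exp (-(y / 2 * Real.cosh t)) * Real.exp (|ν.re| * t) := by ring
      _ ≤ 2 / (y / 2) * Real.exp (-(y / 2 * Real.cosh t / 2)) * Real.exp (|ν.re| * t) := by
          gcongr ?_ * _
          exact Real.mul_exp_neg_mul_le (by positivity) _
      _ ≤ 2 / (y / 2) * Real.exp (-(y / 8 * t ^ 2)) * Real.exp (|ν.re| * t) := by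
          gcongr
          nlinarith
      _ = _ := by
          rw [Real.exp_add]
          ring
  · exact (integrableOn_exp_neg_mul_sq_add_mul (by positivity) _).const_mul _
  · refine ae_of_all _ fun t x _ => ?_
    have h : HasDerivAt (fun x : ℝ => -(x : ℂ) * Real.cosh t) (-1 * Real.cosh t) x :=
      ((hasDerivAt_id x).ofReal_comp.neg).mul_const _
    convert! h.cexp.mul_const (Complex.cosh (ν * t)) using 1
    ring

lemma exists_norm_besselK_le (ν : ℂ) :
    ∃ A : ℝ, ∀ y : ℝ, 1 ≤ y → ‖besselK ν y‖ ≤ A * (Real.exp (-y) / √y) := by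
  obtain ⟨A, hA⟩ := exists_integral_exp_neg_mul_sq_add_mul_le (b := 1 / 2) (a := |ν.re|)
    (by norm_num) (abs_nonneg _)
  refine ⟨A, fun y hy => ?_⟩
  have hy0 : 0 < y := by linarith
  calc ‖besselK ν y‖
      ≤ ∫ t in Ioi (0 : ℝ), Real.exp (-y) *
          Real.exp (-(1 / 2 * y * t ^ 2) + |ν.re| * t) := by
        refine norm_integral_le_of_norm_le
          ((integrableOn_exp_neg_mul_sq_add_mul (by positivity) _).const_mul _) ?_
        exact (ae_restrict_mem measurableSet_Ioi).mono fun t ht =>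
          norm_besselK_integrand_le_gaussian ν hy0 (le_of_lt ht)
    _ ≤ Real.exp (-y) * (A / √y) := by
        rw [integral_const_mul]
        gcongr
        exact hA y hy
    _ = _ := by ring

lemma exists_norm_besselK_add_besselKDeriv_le (ν : ℂ) :
    ∃ A : ℝ, ∀ y : ℝ, 1 ≤ y →
      ‖besselK ν y + besselKDeriv ν y‖ ≤ A * (Real.exp (-y) / √y / y) := by
  obtain ⟨A, hA⟩ := exists_integral_exp_neg_mul_sq_add_mul_le (b := 1 / 4) (a := |ν.re|)
    (by norm_num) (abs_nonneg _)
  refine ⟨2 * A, fun y hy => ?_⟩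
  have hy0 : 0 < y := by linarith
  have hsum : besselK ν y + besselKDeriv ν y = ∫ t in Ioi (0 : ℝ), ((1 - Real.cosh t : ℝ) : ℂ) *
      (Complex.exp (-(y : ℂ) * Real.cosh t) * Complex.cosh (ν * t)) := by
    rw [besselK, besselKDeriv, ← integral_add (integrableOn_besselK_integrand ν hy0)
      (integrableOn_and_hasDerivAt_besselK ν hy0).1]
    congr 1 with t
    push_cast
    ring
  calc ‖besselK ν y + besselKDeriv ν y‖
      ≤ ∫ t in Ioi (0 : ℝ), 2 / y * Real.exp (-y) *
          Real.exp (-(1 / 4 * y * t ^ 2) + |ν.re| * t) := by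
        rw [hsum]
        refine norm_integral_le_of_norm_le
          ((integrableOn_exp_neg_mul_sq_add_mul (by positivity) _).const_mul _) ?_
        exact (ae_restrict_mem measurableSet_Ioi).mono fun t ht =>
          norm_cosh_sub_one_mul_besselK_integrand_le ν hy0 (le_of_lt ht)
    _ ≤ 2 / y * Real.exp (-y) * (A / √y) := by
        rw [integral_const_mul]
        gcongr
        exact hA y hy
    _ = _ := by ring

/-- The weight of the Poisson integral for `besselI`, with the endpoint `1` moved to `0`. -/
noncomputable def poissonWeight (ν : ℂ) (r : ℝ) : ℂ :=
  ((r * (2 - r) : ℝ) : ℂ) ^ (ν - 1 / 2)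

/-- The integral in Poisson's representation of `besselI`. -/
noncomputable def poissonIntegral (ν : ℂ) (y : ℝ) : ℂ :=
  ∫ r in Ioo (0 : ℝ) 1, (Real.cosh (y * (1 - r)) : ℂ) * poissonWeight ν r

/-- The derivative of `poissonIntegral` in the real argument. -/
noncomputable def poissonIntegralDeriv (ν : ℂ) (y : ℝ) : ℂ :=
  ∫ r in Ioo (0 : ℝ) 1, (((1 - r) * Real.sinh (y * (1 - r)) : ℝ) : ℂ) * poissonWeight ν r

lemma norm_poissonWeight_le (ν : ℂ) {r : ℝ} (hr : r ∈ Ioo (0 : ℝ) 1) :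
    ‖poissonWeight ν r‖ ≤ (1 + 2 ^ (ν.re - 1 / 2)) * r ^ (ν.re - 1 / 2) := by
  obtain ⟨h0, h1⟩ := hr
  have h2 : 0 < 2 - r := by linarith
  rw [poissonWeight, Complex.norm_cpow_eq_rpow_re_of_pos (by positivity),
    Real.mul_rpow h0.le h2.le, mul_comm]
  simp only [Complex.sub_re, one_div, Complex.inv_re, Complex.re_ofNat, Complex.normSq_ofNat]
  norm_num
  gcongr
  rcases le_total 0 (ν.re - 1 / 2) with h | h
  · have : (2 - r) ^ (ν.re - 1 / 2) ≤ 2 ^ (ν.re - 1 / 2) :=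
      Real.rpow_le_rpow h2.le (by linarith) h
    linarith
  · have := Real.rpow_le_one_of_one_le_of_nonpos (x := 2 - r) (by linarith) h
    have : (0 : ℝ) ≤ 2 ^ (ν.re - 1 / 2) := by positivity
    linarith

lemma measurable_poissonWeight (ν : ℂ) : Measurable (poissonWeight ν) := by
  unfold poissonWeight
  fun_prop

lemma integrableOn_Ioo_rpow {q : ℝ} (hq : -1 < q) :
    IntegrableOn (fun r : ℝ => r ^ q) (Ioo 0 1) :=
  (intervalIntegrable_iff_integrableOn_Ioo_of_le zero_le_one).1
    (intervalIntegral.intervalIntegrable_rpow' hq)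

lemma integrableOn_poissonWeight {ν : ℂ} (hν : 0 < ν.re) :
    IntegrableOn (poissonWeight ν) (Ioo 0 1) :=
  Integrable.mono' ((integrableOn_Ioo_rpow (by linarith)).const_mul _)
    (measurable_poissonWeight ν).aestronglyMeasurable
    ((ae_restrict_mem measurableSet_Ioo).mono fun _ hr => norm_poissonWeight_le ν hr)

lemma image_one_sub_sq_Ioo : (fun r : ℝ => (1 - r) ^ 2) '' Ioo 0 1 = Ioo 0 1 := by
  ext u
  constructor
  · rintro ⟨r, ⟨h0, h1⟩, rfl⟩
    constructor <;> dsimp only <;> nlinarith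
  · rintro ⟨h0, h1⟩
    refine ⟨1 - √u, ⟨?_, ?_⟩, ?_⟩
    · have : √u < 1 := by rwa [Real.sqrt_lt' one_pos, one_pow]
      linarith
    · linarith [Real.sqrt_pos.2 h0]
    · simp [Real.sq_sqrt h0.le]

lemma integral_pow_mul_poissonWeight (ν : ℂ) (k : ℕ) :
    ∫ r in Ioo (0 : ℝ) 1, (((1 - r) ^ (2 * k) : ℝ) : ℂ) * poissonWeight ν r =
      Complex.betaIntegral (k + 1 / 2) (ν + 1 / 2) / 2 := by
  have hinj : InjOn (fun r : ℝ => (1 - r) ^ 2) (Ioo 0 1) := by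
    intro a ha b hb hab
    have := (pow_left_inj₀ (by linarith [ha.2]) (by linarith [hb.2]) two_ne_zero).1 hab
    linarith
  have hderiv : ∀ r ∈ Ioo (0 : ℝ) 1,
      HasDerivWithinAt (fun r : ℝ => (1 - r) ^ 2) (-(2 * (1 - r))) (Ioo 0 1) r := by
    intro r _
    have := (((hasDerivAt_id r).const_sub 1).pow 2).hasDerivWithinAt (s := Ioo 0 1)
    convert! this using 1
    simp
  have hsubst := integral_image_eq_integral_abs_deriv_smul measurableSet_Ioo hderiv hinj
    fun u : ℝ => (u : ℂ) ^ ((k : ℂ) + 1 / 2 - 1) * (1 - (u : ℂ)) ^ (ν + 1 / 2 - 1)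
  rw [image_one_sub_sq_Ioo] at hsubst
  rw [Complex.betaIntegral, intervalIntegral.integral_of_le zero_le_one,
    integral_Ioc_eq_integral_Ioo, hsubst, eq_div_iff two_ne_zero, ← integral_mul_const]
  refine setIntegral_congr_fun measurableSet_Ioo fun r hr => ?_
  have hs : 0 < 1 - r := by linarith [hr.2]
  have h1 : (((1 - r) ^ 2 : ℝ) : ℂ) ^ ((k : ℂ) + 1 / 2 - 1) =
      (((1 - r) ^ (2 * k) / (1 - r) : ℝ) : ℂ) := by
    rw [show (k : ℂ) + 1 / 2 - 1 = ((k - 1 / 2 : ℝ) : ℂ) by push_cast; ring,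
      ← Complex.ofReal_cpow (by positivity), ← Real.rpow_natCast, ← Real.rpow_mul hs.le,
      ← Real.rpow_natCast, ← Real.rpow_sub_one hs.ne']
    congr 2
    push_cast
    ring
  have h2 : (1 : ℂ) - (((1 - r) ^ 2 : ℝ) : ℂ) = ((r * (2 - r) : ℝ) : ℂ) := by
    push_cast
    ring
  simp only [h1, h2]
  rw [abs_neg, abs_of_pos (by positivity), poissonWeight, Complex.real_smul,
    show ν + 1 / 2 - 1 = ν - 1 / 2 by ring]
  have hs' : (1 : ℂ) - r ≠ 0 := by exact_mod_cast hs.ne'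
  push_cast
  field_simp

lemma hasSum_poissonIntegral {ν : ℂ} (hν : 0 < ν.re) (y : ℝ) :
    HasSum (fun k : ℕ => ((y ^ (2 * k) / (2 * k).factorial : ℝ) : ℂ) *
      (Complex.betaIntegral (k + 1 / 2) (ν + 1 / 2) / 2)) (poissonIntegral ν y) := by
  have hW := integrableOn_poissonWeight hν
  have hbound : ∀ k : ℕ, ∀ r ∈ Ioo (0 : ℝ) 1,
      ‖(((1 - r) ^ (2 * k) : ℝ) : ℂ) * poissonWeight ν r‖ ≤ ‖poissonWeight ν r‖ := by
    intro k r hr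
    have h0 : 0 ≤ 1 - r := by linarith [hr.2]
    rw [norm_mul, Complex.norm_real, Real.norm_eq_abs, abs_of_nonneg (by positivity)]
    exact mul_le_of_le_one_left (norm_nonneg _) (pow_le_one₀ h0 (by linarith [hr.1]))
  have hint : ∀ k : ℕ, IntegrableOn
      (fun r : ℝ => (((1 - r) ^ (2 * k) : ℝ) : ℂ) * poissonWeight ν r) (Ioo 0 1) := by
    intro k
    refine Integrable.mono hW ?_
      ((ae_restrict_mem measurableSet_Ioo).mono fun r hr => hbound k r hr)
    have := measurable_poissonWeight ν
    exact Measurable.aestronglyMeasurable (by fun_prop)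
  have h := hasSum_integral_of_summable_integral_norm (μ := volume.restrict (Ioo (0 : ℝ) 1))
    (F := fun (k : ℕ) (r : ℝ) => ((y ^ (2 * k) / (2 * k).factorial : ℝ) : ℂ) *
      ((((1 - r) ^ (2 * k) : ℝ) : ℂ) * poissonWeight ν r))
    (fun k => (hint k).const_mul _) ?_
  · simp only [integral_const_mul, integral_pow_mul_poissonWeight] at h
    convert! h using 1
    refine integral_congr_ae (ae_of_all _ fun r => ?_)
    have h2 := (Complex.hasSum_ofReal.2 (Real.hasSum_cosh (y * (1 - r)))).mul_right
      (poissonWeight ν r)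
    refine h2.tsum_eq.symm.trans (tsum_congr fun k => ?_)
    rw [mul_pow]
    push_cast
    ring
  · refine Summable.of_nonneg_of_le (fun k => integral_nonneg fun r => norm_nonneg _) (fun k => ?_)
      ((Real.hasSum_cosh y).summable.mul_right (∫ r in Ioo (0 : ℝ) 1, ‖poissonWeight ν r‖))
    have hpos : 0 ≤ y ^ (2 * k) / (2 * k).factorial := by
      rw [pow_mul]
      positivity
    simp only [norm_mul _ (_ * _), Complex.norm_real, Real.norm_eq_abs, abs_of_nonneg hpos,
      integral_const_mul]
    refine mul_le_mul_of_nonneg_left ?_ hpos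
    exact setIntegral_mono_on (hint k).norm hW.norm measurableSet_Ioo (hbound k)

/-- The constant in Poisson's integral representation of `besselI`. -/
noncomputable def poissonConst (ν : ℂ) : ℂ := 2 / (√Real.pi * Complex.Gamma (ν + 1 / 2))

lemma besselI_eq_poissonIntegral {ν : ℂ} (hν : 0 < ν.re) {y : ℝ} (hy : 0 < y) :
    besselI ν y = poissonConst ν * ((y / 2 : ℝ) : ℂ) ^ ν * poissonIntegral ν y := by
  rw [besselI, ← ((hasSum_poissonIntegral hν y).mul_left _).tsum_eq]
  refine tsum_congr fun k => ?_
  have hhalf : 0 < (ν + 1 / 2).re := by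
    simp only [Complex.add_re, one_div, Complex.inv_re, Complex.re_ofNat, Complex.normSq_ofNat]
    norm_num
    linarith
  have hkhalf : 0 < ((k : ℂ) + 1 / 2).re := by
    simp only [Complex.add_re, one_div, Complex.inv_re, Complex.re_ofNat, Complex.normSq_ofNat,
      Complex.natCast_re]
    positivity
  have hG1 : Complex.Gamma (ν + 1 / 2) ≠ 0 := Complex.Gamma_ne_zero_of_re_pos hhalf
  have hG2 : Complex.Gamma (ν + k + 1) ≠ 0 := Complex.Gamma_ne_zero_of_re_pos (by
    simp only [Complex.add_re, Complex.natCast_re, Complex.one_re]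
    positivity)
  have hbeta := Complex.Gamma_mul_Gamma_eq_betaIntegral hkhalf hhalf
  rw [show (k : ℂ) + 1 / 2 + (ν + 1 / 2) = ν + k + 1 by ring] at hbeta
  have hdup := Complex.Gamma_mul_Gamma_add_half ((k : ℂ) + 1 / 2)
  rw [show (k : ℂ) + 1 / 2 + 1 / 2 = k + 1 by ring,
    show 2 * ((k : ℂ) + 1 / 2) = ((2 * k : ℕ) : ℂ) + 1 by push_cast; ring,
    Complex.Gamma_nat_eq_factorial, Complex.Gamma_nat_eq_factorial,
    show 1 - (((2 * k : ℕ) : ℂ) + 1) = -((2 * k : ℕ) : ℂ) by ring,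
    Complex.cpow_neg, Complex.cpow_natCast] at hdup
  have hpi : ((√Real.pi : ℝ) : ℂ) ≠ 0 := by
    exact_mod_cast (Real.sqrt_pos.2 Real.pi_pos).ne'
  have hf1 : ((k.factorial : ℕ) : ℂ) ≠ 0 := by exact_mod_cast k.factorial_ne_zero
  have hf2 : (((2 * k).factorial : ℕ) : ℂ) ≠ 0 := by exact_mod_cast (2 * k).factorial_ne_zero
  have hpow : ((y : ℂ) / 2) ^ (ν + 2 * (k : ℂ)) =
      ((y / 2 : ℝ) : ℂ) ^ ν * ((y : ℂ) ^ (2 * k) / 2 ^ (2 * k)) := by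
    have hy2 : (y : ℂ) / 2 ≠ 0 := by
      have : (y : ℂ) ≠ 0 := by exact_mod_cast hy.ne'
      exact div_ne_zero this two_ne_zero
    rw [Complex.cpow_add _ _ hy2, show 2 * (k : ℂ) = ((2 * k : ℕ) : ℂ) by push_cast; ring,
      Complex.cpow_natCast, div_pow]
    push_cast
    rfl
  have hB : Complex.betaIntegral (k + 1 / 2) (ν + 1 / 2) =
      ((2 * k).factorial * ((2 : ℂ) ^ (2 * k))⁻¹ * √Real.pi / k.factorial) *
        Complex.Gamma (ν + 1 / 2) / Complex.Gamma (ν + k + 1) := by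
    rw [eq_div_iff hG2, ← hdup, mul_div_cancel_right₀ _ hf1, hbeta]
    ring
  rw [hpow, hB, poissonConst]
  generalize Complex.Gamma (ν + 1 / 2) = G at hG1 ⊢
  push_cast
  field_simp

lemma Real.sinh_le_exp (z : ℝ) : Real.sinh z ≤ Real.exp z := by
  rw [Real.sinh_eq]
  linarith [Real.exp_pos z, Real.exp_pos (-z)]

lemma Real.cosh_le_exp {z : ℝ} (hz : 0 ≤ z) : Real.cosh z ≤ Real.exp z := by
  rw [← Real.cosh_add_sinh]
  linarith [Real.sinh_nonneg_iff.2 hz]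

lemma norm_one_sub_mul_sinh_mul_le (w : ℂ) {r x : ℝ} (hr : r ∈ Ioo (0 : ℝ) 1) (hx : 0 ≤ x) :
    ‖(((1 - r) * Real.sinh (x * (1 - r)) : ℝ) : ℂ) * w‖ ≤ Real.exp x * ‖w‖ := by
  have h0 : 0 ≤ 1 - r := by linarith [hr.2]
  have hs : 0 ≤ Real.sinh (x * (1 - r)) := Real.sinh_nonneg_iff.2 (by positivity)
  rw [norm_mul, Complex.norm_real, Real.norm_eq_abs, abs_of_nonneg (by positivity)]
  gcongr
  calc (1 - r) * Real.sinh (x * (1 - r)) ≤ 1 * Real.exp (x * (1 - r)) := by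
        gcongr
        · linarith [hr.1]
        · exact Real.sinh_le_exp _
    _ ≤ Real.exp x := by
        rw [one_mul, Real.exp_le_exp]
        nlinarith [hr.1]

lemma norm_cosh_mul_le (w : ℂ) {r y : ℝ} (hr : r ∈ Ioo (0 : ℝ) 1) (hy : 0 ≤ y) :
    ‖(Real.cosh (y * (1 - r)) : ℂ) * w‖ ≤ Real.exp y * Real.exp (-(y * r)) * ‖w‖ := by
  have h0 : 0 ≤ 1 - r := by linarith [hr.2]
  rw [norm_mul, Complex.norm_real, Real.norm_eq_abs, abs_of_pos (Real.cosh_pos _), ← Real.exp_add]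
  gcongr
  refine (Real.cosh_le_exp (by positivity)).trans_eq ?_
  ring_nf

lemma norm_one_sub_mul_sinh_sub_cosh_mul_le (w : ℂ) {r y : ℝ} (hr : r ∈ Ioo (0 : ℝ) 1)
    (hy : 0 ≤ y) :
    ‖(((1 - r) * Real.sinh (y * (1 - r)) - Real.cosh (y * (1 - r)) : ℝ) : ℂ) * w‖ ≤
      (1 + Real.exp y * (r * Real.exp (-(y * r)))) * ‖w‖ := by
  have h0 : 0 ≤ 1 - r := by linarith [hr.2]
  have hz : 0 ≤ y * (1 - r) := by positivity
  have hs : 0 ≤ Real.sinh (y * (1 - r)) := Real.sinh_nonneg_iff.2 hz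
  have hsub := Real.cosh_sub_sinh (y * (1 - r))
  have hle : Real.exp (-(y * (1 - r))) ≤ 1 := Real.exp_le_one_iff.2 (by linarith)
  have hsinh : r * Real.sinh (y * (1 - r)) ≤ r * Real.exp (y * (1 - r)) :=
    mul_le_mul_of_nonneg_left (Real.sinh_le_exp _) hr.1.le
  have hexp : Real.exp (y * (1 - r)) = Real.exp y * Real.exp (-(y * r)) := by
    rw [← Real.exp_add]
    ring_nf
  have hrs : 0 ≤ r * Real.sinh (y * (1 - r)) := mul_nonneg hr.1.le hs
  rw [norm_mul, Complex.norm_real, Real.norm_eq_abs]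
  gcongr
  rw [abs_le]
  constructor
  · rw [hexp] at hsinh
    linarith
  · have : 0 ≤ Real.exp y * (r * Real.exp (-(y * r))) := by
      have := hr.1
      positivity
    linarith [Real.exp_pos (-(y * (1 - r)))]

lemma integrableOn_cosh_mul_poissonWeight {ν : ℂ} (hν : 0 < ν.re) {y : ℝ} (hy : 0 ≤ y) :
    IntegrableOn (fun r : ℝ => (Real.cosh (y * (1 - r)) : ℂ) * poissonWeight ν r) (Ioo 0 1) := by
  refine Integrable.mono' ((integrableOn_poissonWeight hν).norm.const_mul (Real.exp y)) ?_ ?_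
  · have := measurable_poissonWeight ν
    exact Measurable.aestronglyMeasurable (by fun_prop)
  · refine (ae_restrict_mem measurableSet_Ioo).mono fun r hr => (norm_cosh_mul_le _ hr hy).trans ?_
    gcongr
    exact mul_le_of_le_one_right (Real.exp_pos _).le
      (Real.exp_le_one_iff.2 (by nlinarith [hr.1]))

lemma integrableOn_and_hasDerivAt_poissonIntegral {ν : ℂ} (hν : 0 < ν.re) {y : ℝ} (hy : 0 < y) :
    IntegrableOn (fun r : ℝ =>
      (((1 - r) * Real.sinh (y * (1 - r)) : ℝ) : ℂ) * poissonWeight ν r) (Ioo 0 1) ∧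
    HasDerivAt (poissonIntegral ν) (poissonIntegralDeriv ν y) y := by
  have hW := measurable_poissonWeight ν
  refine hasDerivAt_integral_of_dominated_loc_of_deriv_le (𝕜 := ℝ) (s := Ioo 0 (y + 1))
    (F := fun (x r : ℝ) => (Real.cosh (x * (1 - r)) : ℂ) * poissonWeight ν r)
    (F' := fun (x r : ℝ) =>
      (((1 - r) * Real.sinh (x * (1 - r)) : ℝ) : ℂ) * poissonWeight ν r)
    (bound := fun r => Real.exp (y + 1) * ‖poissonWeight ν r‖)
    (Ioo_mem_nhds hy (by linarith)) ?_ (integrableOn_cosh_mul_poissonWeight hν hy.le) ?_ ?_ ?_ ?_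
  · exact Eventually.of_forall fun x => Measurable.aestronglyMeasurable (by fun_prop)
  · exact Measurable.aestronglyMeasurable (by fun_prop)
  · refine (ae_restrict_mem measurableSet_Ioo).mono fun r hr x hx =>
      (norm_one_sub_mul_sinh_mul_le _ hr hx.1.le).trans ?_
    gcongr
    exact hx.2.le
  · exact (integrableOn_poissonWeight hν).norm.const_mul _
  · refine ae_of_all _ fun r x _ => ?_
    have h := (((hasDerivAt_id x).mul_const (1 - r)).cosh).ofReal_comp.mul_const
      (poissonWeight ν r)
    convert! h using 1
    simp only [id]
    push_cast
    ring

/-- The derivative of `besselI`, expressed through Poisson's integral. -/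
noncomputable def besselIDeriv (ν : ℂ) (y : ℝ) : ℂ :=
  ν / y * besselI ν y + poissonConst ν * ((y / 2 : ℝ) : ℂ) ^ ν * poissonIntegralDeriv ν y

lemma hasDerivAt_besselI {ν : ℂ} (hν : 0 < ν.re) {y : ℝ} (hy : 0 < y) :
    HasDerivAt (besselI ν) (besselIDeriv ν y) y := by
  have hν0 : ν ≠ 0 := fun h => by simp [h] at hν
  have hy0 : (y : ℂ) ≠ 0 := by exact_mod_cast hy.ne'
  have hpow : HasDerivAt (fun x : ℝ => ((x / 2 : ℝ) : ℂ) ^ ν)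
      (ν / y * ((y / 2 : ℝ) : ℂ) ^ ν) y := by
    have h := (hasDerivAt_ofReal_cpow_const (x := y / 2) (by positivity) hν0).scomp y
      ((hasDerivAt_id y).div_const 2)
    convert! h using 1
    rw [Complex.cpow_sub _ _ (by exact_mod_cast (by positivity : y / 2 ≠ 0)), Complex.cpow_one,
      Complex.real_smul]
    push_cast
    field_simp
  have h := (hpow.const_mul (poissonConst ν)).mul
    (integrableOn_and_hasDerivAt_poissonIntegral hν hy).2
  refine (h.congr_of_eventuallyEq ?_).congr_deriv ?_
  · filter_upwards [Ioi_mem_nhds hy] with x hx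
    simpa using besselI_eq_poissonIntegral hν hx
  · rw [besselIDeriv, besselI_eq_poissonIntegral hν hy]
    ring

lemma integral_Ioo_rpow_mul_exp_neg_mul_le {a y : ℝ} (ha : 0 < a) (hy : 0 < y) :
    IntegrableOn (fun r : ℝ => r ^ (a - 1) * Real.exp (-(y * r))) (Ioo 0 1) ∧
    ∫ r in Ioo (0 : ℝ) 1, r ^ (a - 1) * Real.exp (-(y * r)) ≤ (1 / y) ^ a * Real.Gamma a := by
  have hint : IntegrableOn (fun r : ℝ => r ^ (a - 1) * Real.exp (-(y * r))) (Ioi 0) := by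
    simpa using integrableOn_rpow_mul_exp_neg_mul_rpow (s := a - 1) (by linarith) one_pos hy
  refine ⟨hint.mono_set Ioo_subset_Ioi_self, ?_⟩
  rw [← Real.integral_rpow_mul_exp_neg_mul_Ioi ha hy]
  refine setIntegral_mono_set hint ?_ Ioo_subset_Ioi_self.eventuallyLE
  refine (ae_restrict_mem measurableSet_Ioi).mono fun r hr => ?_
  have : (0 : ℝ) < r := hr
  simp only [Pi.zero_apply]
  positivity

lemma exists_norm_poissonIntegral_le {ν : ℂ} (hν : 0 < ν.re) :
    ∃ B : ℝ, 0 ≤ B ∧ ∀ y : ℝ, 0 < y →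
      ‖poissonIntegral ν y‖ ≤ B * (Real.exp y * y ^ (-(ν.re + 1 / 2))) := by
  have hG : 0 < Real.Gamma (ν.re + 1 / 2) := Real.Gamma_pos_of_pos (by linarith)
  refine ⟨(1 + 2 ^ (ν.re - 1 / 2)) * Real.Gamma (ν.re + 1 / 2), by positivity, fun y hy => ?_⟩
  obtain ⟨hint, hle⟩ := integral_Ioo_rpow_mul_exp_neg_mul_le (a := ν.re + 1 / 2)
    (by linarith) hy
  calc ‖poissonIntegral ν y‖
      ≤ ∫ r in Ioo (0 : ℝ) 1, (1 + 2 ^ (ν.re - 1 / 2)) * Real.exp y *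
          (r ^ (ν.re + 1 / 2 - 1) * Real.exp (-(y * r))) := by
        refine norm_integral_le_of_norm_le (hint.const_mul _) ?_
        refine (ae_restrict_mem measurableSet_Ioo).mono fun r hr =>
          (norm_cosh_mul_le _ hr hy.le).trans ?_
        calc _ ≤ Real.exp y * Real.exp (-(y * r)) *
              ((1 + 2 ^ (ν.re - 1 / 2)) * r ^ (ν.re - 1 / 2)) := by
              gcongr
              exact norm_poissonWeight_le ν hr
          _ = _ := by
              rw [show ν.re + 1 / 2 - 1 = ν.re - 1 / 2 by ring]
              ring
    _ ≤ (1 + 2 ^ (ν.re - 1 / 2)) * Real.exp y *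
          ((1 / y) ^ (ν.re + 1 / 2) * Real.Gamma (ν.re + 1 / 2)) := by
        rw [integral_const_mul]
        gcongr
    _ = _ := by
        rw [one_div y, Real.inv_rpow hy.le, Real.rpow_neg hy.le]
        ring

lemma exists_norm_poissonIntegralDeriv_sub_le {ν : ℂ} (hν : 0 < ν.re) :
    ∃ B : ℝ, 0 ≤ B ∧ ∀ y : ℝ, 0 < y →
      ‖poissonIntegralDeriv ν y - poissonIntegral ν y‖ ≤
        B * (1 + Real.exp y * y ^ (-(ν.re + 3 / 2))) := by
  have hG : 0 < Real.Gamma (ν.re + 3 / 2) := Real.Gamma_pos_of_pos (by linarith)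
  have hC : (0 : ℝ) ≤ 1 + 2 ^ (ν.re - 1 / 2) := by positivity
  set C : ℝ := 1 + 2 ^ (ν.re - 1 / 2)
  set D : ℝ := ∫ r in Ioo (0 : ℝ) 1, r ^ (ν.re - 1 / 2)
  have hD : 0 ≤ D := setIntegral_nonneg measurableSet_Ioo fun r hr => by
    have := hr.1
    positivity
  have hq := integrableOn_Ioo_rpow (q := ν.re - 1 / 2) (by linarith)
  refine ⟨C * (D + Real.Gamma (ν.re + 3 / 2)), by positivity, fun y hy => ?_⟩
  obtain ⟨hint, hle⟩ := integral_Ioo_rpow_mul_exp_neg_mul_le (a := ν.re + 3 / 2)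
    (by linarith) hy
  have hsub : poissonIntegralDeriv ν y - poissonIntegral ν y = ∫ r in Ioo (0 : ℝ) 1,
      (((1 - r) * Real.sinh (y * (1 - r)) - Real.cosh (y * (1 - r)) : ℝ) : ℂ) *
        poissonWeight ν r := by
    rw [poissonIntegralDeriv, poissonIntegral,
      ← integral_sub (integrableOn_and_hasDerivAt_poissonIntegral hν hy).1
        (integrableOn_cosh_mul_poissonWeight hν hy.le)]
    congr 1 with r
    push_cast
    ring
  calc ‖poissonIntegralDeriv ν y - poissonIntegral ν y‖
      ≤ ∫ r in Ioo (0 : ℝ) 1, (C * r ^ (ν.re - 1 / 2) + C * Real.exp y *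
          (r ^ (ν.re + 3 / 2 - 1) * Real.exp (-(y * r)))) := by
        rw [hsub]
        refine norm_integral_le_of_norm_le ((hq.const_mul _).add (hint.const_mul _)) ?_
        refine (ae_restrict_mem measurableSet_Ioo).mono fun r hr =>
          (norm_one_sub_mul_sinh_sub_cosh_mul_le _ hr hy.le).trans ?_
        have hr0 : 0 < r := hr.1
        calc _ ≤ (1 + Real.exp y * (r * Real.exp (-(y * r)))) *
              (C * r ^ (ν.re - 1 / 2)) := by
              gcongr
              exact norm_poissonWeight_le ν hr
          _ = _ := by
              rw [show ν.re + 3 / 2 - 1 = ν.re - 1 / 2 + 1 by ring, Real.rpow_add_one hr0.ne']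
              ring
    _ ≤ C * D + C * Real.exp y *
          ((1 / y) ^ (ν.re + 3 / 2) * Real.Gamma (ν.re + 3 / 2)) := by
        rw [integral_add (hq.const_mul _) (hint.const_mul _), integral_const_mul,
          integral_const_mul]
        gcongr
    _ = C * D * 1 + C * Real.Gamma (ν.re + 3 / 2) * (Real.exp y * y ^ (-(ν.re + 3 / 2))) := by
        rw [one_div y, Real.inv_rpow hy.le, Real.rpow_neg hy.le]
        ring
    _ ≤ _ := by
        have : 0 ≤ C * D * (Real.exp y * y ^ (-(ν.re + 3 / 2))) := by positivity
        have : 0 ≤ C * Real.Gamma (ν.re + 3 / 2) := by positivity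
        linarith

lemma norm_div_two_cpow (ν : ℂ) {y : ℝ} (hy : 0 < y) :
    ‖((y / 2 : ℝ) : ℂ) ^ ν‖ = (2 ^ ν.re)⁻¹ * y ^ ν.re := by
  rw [Complex.norm_cpow_eq_rpow_re_of_pos (by positivity), Real.div_rpow hy.le zero_le_two]
  ring

lemma exists_norm_besselI_le {ν : ℂ} (hν : 0 < ν.re) :
    ∃ B : ℝ, 0 ≤ B ∧ ∀ y : ℝ, 0 < y → ‖besselI ν y‖ ≤ B * (Real.exp y / √y) := by
  obtain ⟨B, hB, h⟩ := exists_norm_poissonIntegral_le hν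
  refine ⟨‖poissonConst ν‖ * (2 ^ ν.re)⁻¹ * B, by positivity, fun y hy => ?_⟩
  rw [besselI_eq_poissonIntegral hν hy, norm_mul, norm_mul, norm_div_two_cpow ν hy]
  calc _ ≤ ‖poissonConst ν‖ * ((2 ^ ν.re)⁻¹ * y ^ ν.re) *
        (B * (Real.exp y * y ^ (-(ν.re + 1 / 2)))) := by
        gcongr
        exact h y hy
    _ = _ := by
        rw [neg_add, Real.rpow_add hy, Real.rpow_neg hy.le, Real.rpow_neg hy.le,
          ← Real.sqrt_eq_rpow]
        have : y ^ ν.re ≠ 0 := (Real.rpow_pos_of_pos hy _).ne'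
        field_simp

lemma eventually_rpow_le_exp_div_sqrt_div (a : ℝ) :
    ∀ᶠ y : ℝ in atTop, y ^ a ≤ Real.exp y / √y / y := by
  filter_upwards [(isLittleO_rpow_exp_atTop (a + 3 / 2)).bound one_pos, eventually_gt_atTop 0]
    with y h hy
  rw [one_mul, Real.norm_eq_abs, Real.norm_eq_abs, abs_of_pos (by positivity),
    abs_of_pos (Real.exp_pos _), show a + 3 / 2 = a + 1 + 1 / 2 by ring, Real.rpow_add hy,
    Real.rpow_add_one hy.ne', ← Real.sqrt_eq_rpow] at h
  have := Real.sqrt_pos.2 hy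
  rw [le_div_iff₀ hy, le_div_iff₀ this]
  exact h

lemma exists_norm_besselIDeriv_sub_besselI_le {ν : ℂ} (hν : 0 < ν.re) :
    ∃ B : ℝ, ∀ᶠ y : ℝ in atTop,
      ‖besselIDeriv ν y - besselI ν y‖ ≤ B * (Real.exp y / √y / y) := by
  obtain ⟨B₁, hB₁, h₁⟩ := exists_norm_besselI_le hν
  obtain ⟨B₂, hB₂, h₂⟩ := exists_norm_poissonIntegralDeriv_sub_le hν
  refine ⟨‖ν‖ * B₁ + 2 * (‖poissonConst ν‖ * (2 ^ ν.re)⁻¹ * B₂), ?_⟩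
  filter_upwards [eventually_rpow_le_exp_div_sqrt_div ν.re, eventually_gt_atTop 0] with y hexp hy
  have hsplit : besselIDeriv ν y - besselI ν y = ν / y * besselI ν y +
      poissonConst ν * ((y / 2 : ℝ) : ℂ) ^ ν *
        (poissonIntegralDeriv ν y - poissonIntegral ν y) := by
    rw [mul_sub, ← besselI_eq_poissonIntegral hν hy, besselIDeriv]
    ring
  have hfirst : ‖ν / y * besselI ν y‖ ≤ ‖ν‖ * B₁ * (Real.exp y / √y / y) := by
    rw [norm_mul, norm_div, Complex.norm_real, Real.norm_eq_abs, abs_of_pos hy]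
    calc _ ≤ ‖ν‖ / y * (B₁ * (Real.exp y / √y)) := by
          gcongr
          exact h₁ y hy
      _ = _ := by ring
  have hsecond : ‖poissonConst ν * ((y / 2 : ℝ) : ℂ) ^ ν *
      (poissonIntegralDeriv ν y - poissonIntegral ν y)‖ ≤
      2 * (‖poissonConst ν‖ * (2 ^ ν.re)⁻¹ * B₂) * (Real.exp y / √y / y) := by
    rw [norm_mul, norm_mul, norm_div_two_cpow ν hy]
    calc _ ≤ ‖poissonConst ν‖ * ((2 ^ ν.re)⁻¹ * y ^ ν.re) *
          (B₂ * (1 + Real.exp y * y ^ (-(ν.re + 3 / 2)))) := by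
          gcongr
          exact h₂ y hy
      _ = ‖poissonConst ν‖ * (2 ^ ν.re)⁻¹ * B₂ * (y ^ ν.re + Real.exp y / √y / y) := by
          rw [show -(ν.re + 3 / 2) = -ν.re + -(1 / 2) + -1 by ring, Real.rpow_add hy,
            Real.rpow_add hy, Real.rpow_neg hy.le, Real.rpow_neg hy.le, ← Real.sqrt_eq_rpow,
            Real.rpow_neg_one]
          have : y ^ ν.re ≠ 0 := (Real.rpow_pos_of_pos hy _).ne'
          field_simp
      _ ≤ ‖poissonConst ν‖ * (2 ^ ν.re)⁻¹ * B₂ *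
            (Real.exp y / √y / y + Real.exp y / √y / y) := by
          gcongr
      _ = _ := by ring
  rw [hsplit, add_mul]
  exact (norm_add_le _ _).trans (add_le_add hfirst hsecond)

lemma tendsto_mul_deriv_besselK_mul_besselI (μ : ℂ) {ν : ℂ} (hν : 0 < ν.re) :
    Tendsto (fun y : ℝ => (y : ℂ) *
      (besselKDeriv μ y * besselI ν y + besselK μ y * besselIDeriv ν y)) atTop (𝓝 0) := by
  obtain ⟨A₁, hK⟩ := exists_norm_besselK_le μ
  obtain ⟨A₂, hK'⟩ := exists_norm_besselK_add_besselKDeriv_le μ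
  obtain ⟨B₁, _, hI⟩ := exists_norm_besselI_le hν
  obtain ⟨B₂, hI'⟩ := exists_norm_besselIDeriv_sub_besselI_le hν
  refine squeeze_zero_norm' (a := fun y : ℝ => (A₂ * B₁ + A₁ * B₂) / y) ?_
    (tendsto_const_nhds.div_atTop tendsto_id)
  filter_upwards [hI', eventually_ge_atTop 1] with y hI'y hy
  have hy0 : 0 < y := by linarith
  have hexp : Real.exp (-y) * Real.exp y = 1 := by
    rw [← Real.exp_add]
    simp
  have hsq : √y * √y = y := Real.mul_self_sqrt hy0.le
  have hs : 0 < √y := Real.sqrt_pos.2 hy0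
  rw [show besselKDeriv μ y * besselI ν y + besselK μ y * besselIDeriv ν y =
    (besselK μ y + besselKDeriv μ y) * besselI ν y +
      besselK μ y * (besselIDeriv ν y - besselI ν y) by ring, norm_mul, Complex.norm_real,
    Real.norm_eq_abs, abs_of_pos hy0]
  have h1 : ‖(besselK μ y + besselKDeriv μ y) * besselI ν y‖ ≤
      A₂ * (Real.exp (-y) / √y / y) * (B₁ * (Real.exp y / √y)) :=
    norm_mul_le_of_le (hK' y hy) (hI y hy0)
  have h2 : ‖besselK μ y * (besselIDeriv ν y - besselI ν y)‖ ≤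
      A₁ * (Real.exp (-y) / √y) * (B₂ * (Real.exp y / √y / y)) :=
    norm_mul_le_of_le (hK y hy) hI'y
  calc _ ≤ y * (A₂ * (Real.exp (-y) / √y / y) * (B₁ * (Real.exp y / √y)) +
        A₁ * (Real.exp (-y) / √y) * (B₂ * (Real.exp y / √y / y))) := by
        gcongr
        exact norm_add_le_of_le h1 h2
    _ = (A₂ * B₁ + A₁ * B₂) * (Real.exp (-y) * Real.exp y) / (√y * √y) := by
        field_simp
    _ = _ := by rw [hexp, hsq, mul_one]

lemma hasDerivAt_besselK_mul_besselI (μ : ℂ) {ν : ℂ} (hν : 0 < ν.re) {y : ℝ} (hy : 0 < y) :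
    HasDerivAt (fun y : ℝ => besselK μ y * besselI ν y)
      (besselKDeriv μ y * besselI ν y + besselK μ y * besselIDeriv ν y) y :=
  (integrableOn_and_hasDerivAt_besselK μ hy).2.mul (hasDerivAt_besselI hν hy)

/-- for `α > 0` and `τ ≠ 0`,
`x·d/dx[K_{α+iτ}(√x)I_{α−iτ}(√x) − K_{α−iτ}(√x)I_{α+iτ}(√x)] → 0` as `x → +∞`. -/
theorem statement17 (α τ : ℝ) (hα : α > 0) (hτ : τ ≠ 0) :
    Filter.Tendsto
      (fun x : ℝ => (x : ℂ) *
        deriv (fun x' : ℝ =>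
          besselK (α + τ * Complex.I) (Real.sqrt x') *
            besselI (α - τ * Complex.I) (Real.sqrt x') -
          besselK (α - τ * Complex.I) (Real.sqrt x') *
            besselI (α + τ * Complex.I) (Real.sqrt x')) x)
      Filter.atTop (nhds 0) := by
  have hμ : 0 < (α + τ * Complex.I : ℂ).re := by simpa using hα
  have hν : 0 < (α - τ * Complex.I : ℂ).re := by simpa using hα
  set μ : ℂ := α + τ * Complex.I
  set ν : ℂ := α - τ * Complex.I
  have hlim := (((tendsto_mul_deriv_besselK_mul_besselI μ hν).sub
    (tendsto_mul_deriv_besselK_mul_besselI ν hμ)).const_mul (1 / 2)).comp Real.tendsto_sqrt_atTop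
  rw [sub_zero, mul_zero] at hlim
  refine hlim.congr' ?_
  filter_upwards [eventually_gt_atTop 0] with x hx
  have hs : 0 < √x := Real.sqrt_pos.2 hx
  have hs' : (√x : ℂ) ≠ 0 := by exact_mod_cast hs.ne'
  have hsq : (x : ℂ) = √x * √x := by exact_mod_cast (Real.mul_self_sqrt hx.le).symm
  have h := ((hasDerivAt_besselK_mul_besselI μ hν hs).sub
    (hasDerivAt_besselK_mul_besselI ν hμ hs)).scomp x (Real.hasDerivAt_sqrt hx.ne')
  have hderiv := h.deriv
  simp only [Function.comp_def, Pi.sub_apply] at hderiv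
  rw [hderiv, Complex.real_smul, hsq]
  simp only [Function.comp_apply]
  push_cast
  field_simp
end

section
/- Let α > −1/4, g ∈ L₁(ℝ), and suppose (G_α g)(x) ∈ L_{ν,1}((0,1)) for some max(−α, 0) < ν < 1/2. Then for s with Re s = ν, the Mellin transform of G_α g exists and satisfies [Γ(s) Γ(1+α−s) / Γ(s+α)] · (G_α g)*(s) = Γ(1/2 − s) ∫_{−∞}^∞ g(τ) Γ(s+iτ) Γ(s−iτ) dτ. -/
/-- The index transform `G_α`. -/
noncomputable def Gtrans (α : ℝ) (g : ℝ → ℝ) (x : ℝ) : ℝ :=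
  2 * Real.sqrt Real.pi *
    ∫ τ : ℝ, (besselK (α + τ * Complex.I) (Real.sqrt x) *
      besselI (α - τ * Complex.I) (Real.sqrt x)).re * g τ / Real.cosh (Real.pi * τ)

/-- The Mellin transform `f*(s) = ∫_0^∞ f(x) x^{s−1} dx`. -/
noncomputable def mellinT (f : ℝ → ℝ) (s : ℂ) : ℂ :=
  ∫ x in Set.Ioi (0 : ℝ), (f x : ℂ) * (x : ℂ) ^ (s - 1)

open MeasureTheory Filter Topology

theorem HasSum.of_eq {f g : ℕ → ℂ} {a b : ℂ} (h : HasSum f a) (hfg : ∀ k, g k = f k)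
    (hab : b = a) : HasSum g b := by
  rw [hab, funext hfg]
  exact h

theorem norm_Gamma_le_Gamma_re {s : ℂ} (hs : 0 < s.re) :
    ‖Complex.Gamma s‖ ≤ Real.Gamma s.re := by
  rw [Complex.Gamma_eq_integral hs, Real.Gamma_eq_integral hs, Complex.GammaIntegral]
  refine (norm_integral_le_integral_norm _).trans_eq ?_
  refine setIntegral_congr_fun measurableSet_Ioi fun x hx => ?_
  have hx : 0 < x := hx
  simp [Complex.norm_cpow_eq_rpow_re_of_pos hx, Complex.norm_exp]

theorem hasSum_Gamma_add_mul_pow {a : ℂ} (ha : 0 < a.re) {t : ℝ} (ht : t ∈ Set.Ioo (0 : ℝ) 1) :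
    HasSum (fun k : ℕ => Complex.Gamma (a + k) / (k.factorial : ℂ) * (t : ℂ) ^ k)
      (Complex.Gamma a * (1 - (t : ℂ)) ^ (-a)) := by
  have h := (Complex.one_div_one_sub_cpow_hasFPowerSeriesOnBall_zero a).hasSum
    (y := (t : ℂ)) (by
      rw [← ENNReal.ofReal_one, Metric.eball_ofReal]
      simp [abs_of_pos ht.1, ht.2])
  have h2 := h.mul_left (Complex.Gamma a)
  have hΓ := Complex.Gamma_ne_zero_of_re_pos ha
  refine h2.of_eq (fun k => ?_) ?_
  · have hz : ∀ j : ℕ, a ≠ -j := by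
      rintro j rfl
      have : (0 : ℝ) ≤ j := by positivity
      simp at ha
      linarith
    have h3 := Complex.Gamma_add_nat_div_Gamma_eq (n := k) a hz
    have h4 := Ring.factorial_nsmul_multichoose_eq_ascPochhammer a k
    rw [Polynomial.ascPochhammer_smeval_eq_eval, ← h3, Ring.multichoose_eq, nsmul_eq_mul] at h4
    have hk : (k.factorial : ℂ) ≠ 0 := by exact_mod_cast k.factorial_ne_zero
    simp only [FormalMultilinearSeries.ofScalars_apply_eq, smul_eq_mul]
    rw [eq_div_iff hΓ] at h4
    rw [← h4]
    field_simp
  · simp [Complex.cpow_neg]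

theorem integrableOn_beta {u v : ℝ} (hu : 0 < u) (hv : 0 < v) :
    IntegrableOn (fun t : ℝ => t ^ (u - 1) * (1 - t) ^ (v - 1)) (Set.Ioo 0 1) := by
  have h := Complex.betaIntegral_convergent (u := u) (v := v) (by simpa) (by simpa)
  rw [intervalIntegrable_iff_integrableOn_Ioo_of_le zero_le_one] at h
  refine h.norm.congr ?_
  filter_upwards [ae_restrict_mem measurableSet_Ioo] with t ht
  have h1 : (0 : ℝ) < 1 - t := by linarith [ht.2]
  have h2 : (1 : ℂ) - t = ((1 - t : ℝ) : ℂ) := by push_cast; rfl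
  rw [norm_mul, h2, Complex.norm_cpow_eq_rpow_re_of_pos ht.1, Complex.norm_cpow_eq_rpow_re_of_pos h1]
  simp

theorem setIntegral_beta {u v : ℂ} (hu : 0 < u.re) (hv : 0 < v.re) :
    ∫ t in Set.Ioo (0 : ℝ) 1, (t : ℂ) ^ (u - 1) * (1 - (t : ℂ)) ^ (v - 1) =
      Complex.Gamma u * Complex.Gamma v / Complex.Gamma (u + v) := by
  rw [← Complex.betaIntegral_eq_Gamma_mul_div u v hu hv, Complex.betaIntegral,
    intervalIntegral.integral_of_le zero_le_one, integral_Ioc_eq_integral_Ioo]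

/-- Gauss's summation theorem for the hypergeometric series at `1`. -/
theorem hasSum_gauss {a b c : ℂ} (ha : 0 < a.re) (hb : 0 < b.re) (hc : 0 < (c - a - b).re) :
    HasSum (fun k : ℕ => Complex.Gamma (a + k) * Complex.Gamma (b + k) /
        ((k.factorial : ℂ) * Complex.Gamma (c + k)))
      (Complex.Gamma a * Complex.Gamma b * Complex.Gamma (c - a - b) /
        (Complex.Gamma (c - a) * Complex.Gamma (c - b))) := by
  have hd : 0 < (c - b).re := by simp at hc ⊢; linarith
  have hΓd := Complex.Gamma_ne_zero_of_re_pos hd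
  have key := hasSum_integral_of_dominated_convergence
    (μ := volume.restrict (Set.Ioo (0 : ℝ) 1))
    (F := fun (k : ℕ) (t : ℝ) => Complex.Gamma (a + k) / (k.factorial : ℂ) *
      ((t : ℂ) ^ (b + k - 1) * (1 - (t : ℂ)) ^ (c - b - 1)))
    (f := fun t : ℝ => Complex.Gamma a *
      ((t : ℂ) ^ (b - 1) * (1 - (t : ℂ)) ^ (c - a - b - 1)))
    (fun (k : ℕ) (t : ℝ) => Real.Gamma (a.re + k) / (k.factorial : ℝ) * t ^ k *
      (t ^ (b.re - 1) * (1 - t) ^ ((c - b).re - 1))) ?_ ?_ ?_ ?_ ?_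
  · rw [integral_const_mul, setIntegral_beta hb hc] at key
    have h2 := key.mul_left (Complex.Gamma (c - b))⁻¹
    refine h2.of_eq (fun k => ?_) ?_
    · rw [integral_const_mul, setIntegral_beta (by simp; positivity) hd,
        show b + k + (c - b) = c + k by ring]
      field_simp
    · rw [show b + (c - a - b) = c - a by ring]
      field_simp
  · intro k
    refine Measurable.aestronglyMeasurable ?_
    fun_prop
  · intro k
    filter_upwards [ae_restrict_mem measurableSet_Ioo] with t ht
    have h1 : (0 : ℝ) < 1 - t := by linarith [ht.2]
    have h2 : (1 : ℂ) - t = ((1 - t : ℝ) : ℂ) := by push_cast; rfl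
    have h3 := norm_Gamma_le_Gamma_re (s := a + k) (by simp; positivity)
    rw [norm_mul, norm_mul, h2, Complex.norm_cpow_eq_rpow_re_of_pos ht.1,
      Complex.norm_cpow_eq_rpow_re_of_pos h1, norm_div, mul_assoc (_ / _), ← mul_assoc (t ^ k),
      ← Real.rpow_natCast t k, ← Real.rpow_add ht.1]
    simp only [Complex.norm_natCast, Complex.sub_re, Complex.add_re, Complex.natCast_re,
      Complex.one_re] at h3 ⊢
    rw [show (k : ℝ) + (b.re - 1) = b.re + k - 1 by ring]
    have := Real.rpow_pos_of_pos ht.1 (b.re + k - 1)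
    have := Real.rpow_pos_of_pos h1 (c.re - b.re - 1)
    gcongr
  · filter_upwards [ae_restrict_mem measurableSet_Ioo] with t ht
    have h := hasSum_Gamma_add_mul_pow (a := (a.re : ℂ)) (by simpa) ht
    have h2 := (Complex.hasSum_re h).summable.mul_right (t ^ (b.re - 1) * (1 - t) ^ ((c - b).re - 1))
    convert h2 using 2 with k
    congr 1
    have : Complex.Gamma (a.re + k) / (k.factorial : ℂ) * (t : ℂ) ^ k =
      ((Real.Gamma (a.re + k) / (k.factorial : ℝ) * t ^ k : ℝ) : ℂ) := by
      push_cast [← Complex.Gamma_ofReal]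
      rfl
    rw [this, Complex.ofReal_re]
  · have h := (integrableOn_beta hb hc).const_mul (Real.Gamma a.re)
    refine h.congr ?_
    filter_upwards [ae_restrict_mem measurableSet_Ioo] with t ht
    have h1 : (0 : ℝ) < 1 - t := by linarith [ht.2]
    have h := hasSum_Gamma_add_mul_pow (a := (a.re : ℂ)) (by simpa) ht
    have e1 : ∀ k : ℕ, Complex.Gamma (a.re + k) / (k.factorial : ℂ) * (t : ℂ) ^ k =
      ((Real.Gamma (a.re + k) / (k.factorial : ℝ) * t ^ k : ℝ) : ℂ) := by
      intro k
      push_cast [← Complex.Gamma_ofReal]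
      rfl
    have e2 : Complex.Gamma a.re * (1 - (t : ℂ)) ^ (-(a.re : ℂ)) =
        ((Real.Gamma a.re * (1 - t) ^ (-a.re) : ℝ) : ℂ) := by
      push_cast [← Complex.Gamma_ofReal, Complex.ofReal_cpow h1.le]
      rfl
    simp_rw [e1] at h
    rw [e2, Complex.hasSum_ofReal] at h
    rw [(h.mul_right _).tsum_eq, mul_assoc]
    congr 1
    rw [mul_left_comm, ← Real.rpow_add h1]
    congr 2
    simp
    ring
  · filter_upwards [ae_restrict_mem measurableSet_Ioo] with t ht
    have h1 : (0 : ℝ) < 1 - t := by linarith [ht.2]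
    have h2 : (1 : ℂ) - t ≠ 0 := by
      have : ((1 - t : ℝ) : ℂ) ≠ 0 := by exact_mod_cast h1.ne'
      push_cast at this; exact this
    have ht0 : (t : ℂ) ≠ 0 := by exact_mod_cast ht.1.ne'
    have h := (hasSum_Gamma_add_mul_pow ha ht).mul_right
      ((t : ℂ) ^ (b - 1) * (1 - (t : ℂ)) ^ (c - b - 1))
    refine h.of_eq (fun k => ?_) ?_
    · rw [show b + k - 1 = k + (b - 1) by ring, Complex.cpow_add _ _ ht0, Complex.cpow_natCast]
      ring
    · rw [show c - a - b - 1 = -a + (c - b - 1) by ring, Complex.cpow_add _ _ h2]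
      ring

/-- A lower bound for `Γ` on vertical lines to the right of `Re z = 1/2`. -/
theorem inv_norm_Gamma_le {a : ℝ} (ha : 1 / 2 ≤ a) (τ : ℝ) :
    ‖Complex.Gamma (a + τ * Complex.I)‖⁻¹ ≤
      √(Real.cosh (Real.pi * τ)) * (Real.Gamma a)⁻¹ := by
  have hseq : ∀ᶠ n : ℕ in atTop, ‖Complex.GammaSeq ((1 / 2 : ℝ) + τ * Complex.I) n‖ * Real.GammaSeq a n ≤
      ‖Complex.GammaSeq (a + τ * Complex.I) n‖ * Real.GammaSeq (1 / 2) n := by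
    filter_upwards [eventually_gt_atTop 0] with n hn
    have e : ∀ b : ℝ, ‖Complex.GammaSeq ((b : ℝ) + τ * Complex.I) n‖ =
        (n : ℝ) ^ b * n.factorial / ∏ j ∈ Finset.range (n + 1), √((b + j) ^ 2 + τ ^ 2) := by
      intro b
      rw [Complex.GammaSeq, norm_div, norm_mul, norm_prod, Complex.norm_natCast_cpow_of_pos hn]
      simp only [Complex.add_re, Complex.ofReal_re, Complex.norm_natCast]
      congr 1
      · simp
      · refine Finset.prod_congr rfl fun j _ => ?_
        rw [Complex.norm_eq_sqrt_sq_add_sq]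
        simp
    rw [e, e, Real.GammaSeq, Real.GammaSeq, div_mul_div_comm, div_mul_div_comm, mul_comm
      ((n : ℝ) ^ a * _), ← Finset.prod_mul_distrib, ← Finset.prod_mul_distrib]
    refine div_le_div_of_nonneg_left (by positivity) ?_ ?_
    · refine Finset.prod_pos fun j _ => ?_
      positivity
    · refine Finset.prod_le_prod (fun j _ => by positivity) fun j _ => ?_
      rw [← sq_le_sq₀ (by positivity) (by positivity), mul_pow, mul_pow,
        Real.sq_sqrt (by positivity), Real.sq_sqrt (by positivity)]
      have h1 : (1 / 2 + (j : ℝ)) ^ 2 ≤ (a + j) ^ 2 := by gcongr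
      nlinarith [mul_le_mul_of_nonneg_left h1 (sq_nonneg τ)]
  have hlim : ‖Complex.Gamma ((1 / 2 : ℝ) + τ * Complex.I)‖ * Real.Gamma a ≤
      ‖Complex.Gamma (a + τ * Complex.I)‖ * Real.Gamma (1 / 2) :=
    le_of_tendsto_of_tendsto
      (((Complex.GammaSeq_tendsto_Gamma _).norm).mul (Real.GammaSeq_tendsto_Gamma _))
      (((Complex.GammaSeq_tendsto_Gamma _).norm).mul (Real.GammaSeq_tendsto_Gamma _)) hseq
  have hcosh : ‖Complex.Gamma ((1 / 2 : ℝ) + τ * Complex.I)‖ * √(Real.cosh (Real.pi * τ)) =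
      Real.Gamma (1 / 2) := by
    have h1 := Complex.Gamma_mul_Gamma_one_sub ((1 / 2 : ℝ) + τ * Complex.I)
    have h2 : (1 : ℂ) - ((1 / 2 : ℝ) + τ * Complex.I) =
        (starRingEnd ℂ) ((1 / 2 : ℝ) + τ * Complex.I) := by
      simp only [map_add, map_mul, Complex.conj_ofReal, Complex.conj_I]
      push_cast
      ring
    have h3 : Complex.sin (Real.pi * ((1 / 2 : ℝ) + τ * Complex.I)) =
        (Real.cosh (Real.pi * τ) : ℂ) := by
      rw [show (Real.pi : ℂ) * ((1 / 2 : ℝ) + τ * Complex.I) =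
        (Real.pi * τ : ℂ) * Complex.I + Real.pi / 2 by push_cast; ring,
        Complex.sin_add_pi_div_two, Complex.cos_mul_I]
      push_cast
      rfl
    rw [h2, Complex.Gamma_conj, Complex.mul_conj, h3, Complex.normSq_eq_norm_sq] at h1
    have h4 := (Real.cosh_pos (Real.pi * τ))
    have h5 : ‖Complex.Gamma ((1 / 2 : ℝ) + τ * Complex.I)‖ ^ 2 * Real.cosh (Real.pi * τ) =
        Real.pi := by
      rw [← eq_div_iff h4.ne']
      exact_mod_cast h1
    rw [Real.Gamma_one_half_eq]
    conv_rhs => rw [← h5, Real.sqrt_mul (by positivity), Real.sqrt_sq (norm_nonneg _)]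
  have hG : 0 < Real.Gamma a := Real.Gamma_pos_of_pos (by linarith)
  have hC : 0 < ‖Complex.Gamma (a + τ * Complex.I)‖ :=
    norm_pos_iff.2 (Complex.Gamma_ne_zero_of_re_pos (by simp; linarith))
  have hH : 0 < ‖Complex.Gamma ((1 / 2 : ℝ) + τ * Complex.I)‖ :=
    norm_pos_iff.2 (Complex.Gamma_ne_zero_of_re_pos (by simp))
  rw [← hcosh] at hlim
  rw [inv_le_iff_one_le_mul₀ hC, ← div_eq_mul_inv, div_mul_eq_mul_div, one_le_div hG]
  nlinarith

theorem integral_line_beta {a b : ℂ} (ha : 0 < a.re) (hb : 0 < b.re) :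
    Integrable (fun u : ℝ => Complex.exp ((a - b) * u) * ((2 * Real.cosh u : ℝ) : ℂ) ^ (-(a + b))) ∧
    ∫ u : ℝ, Complex.exp ((a - b) * u) * ((2 * Real.cosh u : ℝ) : ℂ) ^ (-(a + b)) =
      Complex.Gamma a * Complex.Gamma b / (2 * Complex.Gamma (a + b)) := by
  have hd : ∀ u ∈ Set.univ, HasDerivWithinAt (fun u : ℝ => Real.sigmoid (2 * u))
      (Real.sigmoid (2 * u) * (1 - Real.sigmoid (2 * u)) * 2) Set.univ u := by
    intro u _
    have h1 : HasDerivAt (fun u : ℝ => 2 * u) 2 u := by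
      simpa using (hasDerivAt_id u).const_mul (2 : ℝ)
    exact ((Real.hasDerivAt_sigmoid (2 * u)).comp u h1).hasDerivWithinAt
  have hinj : Set.InjOn (fun u : ℝ => Real.sigmoid (2 * u)) Set.univ := by
    intro x _ y _ h
    have := Real.sigmoid_injective h
    linarith
  have him : (fun u : ℝ => Real.sigmoid (2 * u)) '' Set.univ = Set.Ioo 0 1 := by
    rw [← Real.range_sigmoid, Set.image_univ]
    ext x
    constructor
    · rintro ⟨u, rfl⟩
      exact ⟨2 * u, rfl⟩
    · rintro ⟨u, rfl⟩
      exact ⟨u / 2, by simp [mul_div_cancel₀]⟩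
  have hpt : ∀ u : ℝ, |Real.sigmoid (2 * u) * (1 - Real.sigmoid (2 * u)) * 2| •
      ((Real.sigmoid (2 * u) : ℂ) ^ (a - 1) * (1 - (Real.sigmoid (2 * u) : ℂ)) ^ (b - 1)) =
      2 * (Complex.exp ((a - b) * u) * ((2 * Real.cosh u : ℝ) : ℂ) ^ (-(a + b))) := by
    intro u
    have hc : 0 < 2 * Real.cosh u := by positivity
    have e1 : Real.sigmoid (2 * u) = Real.exp (u - Real.log (2 * Real.cosh u)) := by
      rw [Real.exp_sub, Real.exp_log hc, Real.sigmoid_def, Real.cosh_eq, inv_eq_one_div,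
        div_eq_div_iff (by positivity) (by positivity), mul_add, ← Real.exp_add]
      ring_nf
    have e2 : 1 - Real.sigmoid (2 * u) = Real.exp (-u - Real.log (2 * Real.cosh u)) := by
      rw [← Real.sigmoid_neg, show -(2 * u) = 2 * -u by ring]
      rw [Real.exp_sub, Real.exp_log hc, Real.sigmoid_def, Real.cosh_eq, inv_eq_one_div,
        div_eq_div_iff (by positivity) (by positivity), mul_add, ← Real.exp_add]
      ring_nf
    have hcp : ∀ (r : ℝ) (z : ℂ), ((Real.exp r : ℝ) : ℂ) ^ z = Complex.exp (r * z) := by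
      intro r z
      rw [Complex.cpow_def_of_ne_zero (by exact_mod_cast (Real.exp_pos r).ne'),
        ← Complex.ofReal_log (Real.exp_pos r).le, Real.log_exp]
    have e3 : (1 : ℂ) - (Real.sigmoid (2 * u) : ℂ) =
      ((Real.exp (-u - Real.log (2 * Real.cosh u)) : ℝ) : ℂ) := by rw [← e2]; push_cast; rfl
    have e4 : ((2 * Real.cosh u : ℝ) : ℂ) = ((Real.exp (Real.log (2 * Real.cosh u)) : ℝ) : ℂ) := by
      rw [Real.exp_log hc]
    rw [e3, e2, e1, e4, hcp, hcp, hcp, abs_of_pos (by positivity), Complex.real_smul]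
    push_cast
    rw [← Complex.exp_add, ← Complex.exp_add, ← Complex.exp_add, mul_comm _ (2 : ℂ), mul_assoc,
      ← Complex.exp_add]
    congr 2
    ring
  constructor
  · have h := Complex.betaIntegral_convergent ha hb
    rw [intervalIntegrable_iff_integrableOn_Ioo_of_le zero_le_one, ← him,
      integrableOn_image_iff_integrableOn_abs_deriv_smul MeasurableSet.univ hd hinj,
      integrableOn_univ] at h
    simp_rw [hpt] at h
    refine (h.const_mul (2⁻¹ : ℂ)).congr (ae_of_all _ fun u => ?_)
    simp
  · have h := setIntegral_beta ha hb
    rw [← him, integral_image_eq_integral_abs_deriv_smul MeasurableSet.univ hd hinj,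
      setIntegral_univ] at h
    simp_rw [hpt] at h
    rw [integral_const_mul] at h
    rw [mul_comm (2 : ℂ), ← div_div, ← h]
    simp

theorem integral_cosh_mul_of_even {h : ℝ → ℂ} (heven : ∀ u, h (-u) = h u) (μ : ℂ)
    (hi : Integrable (fun u : ℝ => Complex.exp (μ * u) * h u)) :
    IntegrableOn (fun u : ℝ => Complex.cosh (μ * u) * h u) (Set.Ioi 0) ∧
    ∫ u in Set.Ioi (0 : ℝ), Complex.cosh (μ * u) * h u =
      (∫ u : ℝ, Complex.exp (μ * u) * h u) / 2 := by
  have hi2 : Integrable (fun u : ℝ => Complex.exp (-(μ * u)) * h u) := by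
    have := hi.comp_neg
    simpa [heven] using this
  have e : ∀ u : ℝ, Complex.cosh (μ * u) * h u =
      2⁻¹ * (Complex.exp (μ * u) * h u + Complex.exp (-(μ * u)) * h u) := by
    intro u
    rw [Complex.cosh]
    ring
  have e2 : ∫ u in Set.Ioi (0 : ℝ), Complex.exp (-(μ * u)) * h u =
      ∫ u in Set.Iic (0 : ℝ), Complex.exp (μ * u) * h u := by
    have := integral_comp_neg_Ioi (0 : ℝ) (fun u : ℝ => Complex.exp (μ * u) * h u)
    simpa [heven] using this
  simp_rw [e]
  refine ⟨((hi.add hi2).const_mul _).integrableOn, ?_⟩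
  rw [integral_const_mul, integral_add hi.integrableOn hi2.integrableOn, e2, add_comm,
    intervalIntegral.integral_Iic_add_Ioi hi.integrableOn hi.integrableOn]
  ring

theorem integral_cosh_mul_cosh_cpow {μ w : ℂ} (h : |μ.re| < w.re) :
    IntegrableOn (fun u : ℝ => Complex.cosh (μ * u) * (Real.cosh u : ℂ) ^ (-w)) (Set.Ioi 0) ∧
    ∫ u in Set.Ioi (0 : ℝ), Complex.cosh (μ * u) * (Real.cosh u : ℂ) ^ (-w) =
      2 ^ (w - 2) * (Complex.Gamma ((w + μ) / 2) * Complex.Gamma ((w - μ) / 2) /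
        Complex.Gamma w) := by
  obtain ⟨h1, h2⟩ := abs_lt.1 h
  obtain ⟨hi, hv⟩ := integral_line_beta (a := (w + μ) / 2) (b := (w - μ) / 2)
    (by simp; linarith) (by simp; linarith)
  rw [show (w + μ) / 2 - (w - μ) / 2 = μ by ring, show (w + μ) / 2 + (w - μ) / 2 = w by ring]
    at hi hv
  obtain ⟨hi2, hv2⟩ := integral_cosh_mul_of_even
    (h := fun u => ((2 * Real.cosh u : ℝ) : ℂ) ^ (-w)) (fun u => by simp) μ hi
  have e : ∀ u : ℝ, Complex.cosh (μ * u) * (Real.cosh u : ℂ) ^ (-w) =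
      2 ^ w * (Complex.cosh (μ * u) * ((2 * Real.cosh u : ℝ) : ℂ) ^ (-w)) := by
    intro u
    rw [Complex.ofReal_mul, Complex.mul_cpow_ofReal_nonneg (by norm_num) (Real.cosh_pos u).le,
      Complex.cpow_neg ((2 : ℝ) : ℂ)]
    have : (2 : ℂ) ^ w ≠ 0 := by simp [Complex.cpow_eq_zero_iff]
    rw [mul_left_comm, Complex.ofReal_ofNat, mul_inv_cancel_left₀ this]
  simp_rw [e]
  refine ⟨hi2.const_mul _, ?_⟩
  rw [integral_const_mul, hv2, hv, Complex.cpow_sub _ _ two_ne_zero]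
  norm_num
  ring

theorem norm_cosh_le (z : ℂ) : ‖Complex.cosh z‖ ≤ Real.cosh z.re := by
  rw [Complex.cosh, Real.cosh_eq, norm_div]
  simp only [Complex.norm_ofNat]
  gcongr
  refine (norm_add_le _ _).trans_eq ?_
  simp [Complex.norm_exp]

theorem integrableOn_besselK (μ : ℂ) {y : ℝ} (hy : 0 < y) :
    IntegrableOn (fun t : ℝ => Complex.exp (-(y : ℂ) * Real.cosh t) * Complex.cosh (μ * t))
      (Set.Ioi 0) := by
  obtain ⟨n, hn⟩ := exists_nat_gt |μ.re|
  have h := (integral_cosh_mul_cosh_cpow (μ := μ) (w := n) (by simpa using hn)).1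
  refine (h.norm.const_mul (n.factorial / y ^ n)).mono' ?_ (ae_of_all _ fun t => ?_)
  · refine Continuous.aestronglyMeasurable ?_
    have := Complex.continuous_cosh
    fun_prop
  · rw [norm_mul, Complex.norm_exp, norm_mul, Complex.norm_cpow_eq_rpow_re_of_pos (Real.cosh_pos t)]
    have h1 := Real.pow_div_factorial_le_exp (x := y * Real.cosh t) (by positivity) n
    have h2 : ((-(y : ℂ)) * (Real.cosh t : ℂ)).re = -(y * Real.cosh t) := by
      rw [← Complex.ofReal_neg, ← Complex.ofReal_mul, Complex.ofReal_re]; ring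
    rw [h2, mul_comm ‖Complex.cosh (μ * t)‖, ← mul_assoc]
    gcongr
    have hc : 0 < Real.cosh t := Real.cosh_pos t
    simp only [Complex.neg_re, Complex.natCast_re]
    rw [Real.rpow_neg hc.le, Real.rpow_natCast, Real.exp_neg, ← div_eq_mul_inv, div_div,
      inv_eq_one_div, div_le_div_iff₀ (Real.exp_pos _) (by positivity), ← mul_pow, one_mul]
    rwa [div_le_iff₀' (by positivity)] at h1

theorem besselK_ofReal (α y : ℝ) : besselK α y =
    ((∫ t in Set.Ioi (0 : ℝ), Real.exp (-y * Real.cosh t) * Real.cosh (α * t) : ℝ) : ℂ) := by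
  rw [besselK, ← integral_complex_ofReal]
  push_cast
  rfl

theorem norm_besselK_le (μ : ℂ) {y : ℝ} (hy : 0 < y) :
    ‖besselK μ y‖ ≤ ‖besselK (μ.re : ℂ) y‖ := by
  rw [besselK_ofReal, Complex.norm_real, Real.norm_of_nonneg (by positivity), besselK]
  refine norm_integral_le_of_norm_le ?_ (ae_of_all _ fun t => ?_)
  · refine (integrableOn_besselK (μ.re : ℂ) hy).re.congr (ae_of_all _ fun t => ?_)
    have : Complex.exp (-(y : ℂ) * Real.cosh t) * Complex.cosh ((μ.re : ℂ) * t) =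
      ((Real.exp (-y * Real.cosh t) * Real.cosh (μ.re * t) : ℝ) : ℂ) := by push_cast; rfl
    simp only [this]
    exact Complex.ofReal_re _
  · rw [norm_mul, Complex.norm_exp]
    have h2 : ((-(y : ℂ)) * (Real.cosh t : ℂ)).re = -y * Real.cosh t := by
      rw [← Complex.ofReal_neg, ← Complex.ofReal_mul, Complex.ofReal_re]
    rw [h2]
    gcongr
    simpa using norm_cosh_le (μ * t)

/-- The Mellin transform of the Macdonald function. -/
theorem hasMellin_besselK {μ w : ℂ} (h : |μ.re| < w.re) :
    HasMellin (besselK μ) w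
      (2 ^ (w - 2) * (Complex.Gamma ((w + μ) / 2) * Complex.Gamma ((w - μ) / 2))) := by
  have hw : 0 < w.re := (abs_nonneg _).trans_lt h
  have hΓ := Complex.Gamma_ne_zero_of_re_pos hw
  obtain ⟨hi, hv⟩ := integral_cosh_mul_cosh_cpow h
  have hinner : ∀ u : ℝ, ∫ y in Set.Ioi (0 : ℝ), (y : ℂ) ^ (w - 1) *
      (Complex.exp (-(y : ℂ) * Real.cosh u) * Complex.cosh (μ * u)) =
      Complex.Gamma w * (Complex.cosh (μ * u) * (Real.cosh u : ℂ) ^ (-w)) := by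
    intro u
    have h1 := Complex.integral_cpow_mul_exp_neg_mul_Ioi hw (Real.cosh_pos u)
    have h2 : (1 / (Real.cosh u : ℂ)) ^ w = (Real.cosh u : ℂ) ^ (-w) := by
      rw [one_div, Complex.inv_cpow, Complex.cpow_neg]
      rw [Complex.arg_ofReal_of_nonneg (Real.cosh_pos u).le]
      exact Real.pi_pos.ne
    simp_rw [← mul_assoc]
    rw [integral_mul_const]
    have h3 : ∀ y : ℝ, -(y : ℂ) * Real.cosh u = -(Real.cosh u * y) := fun y => by ring
    simp_rw [h3]
    rw [h1, h2]
    ring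
  have hprod : Integrable (fun p : ℝ × ℝ => (p.1 : ℂ) ^ (w - 1) *
      (Complex.exp (-(p.1 : ℂ) * Real.cosh p.2) * Complex.cosh (μ * p.2)))
      ((volume.restrict (Set.Ioi 0)).prod (volume.restrict (Set.Ioi 0))) := by
    rw [integrable_prod_iff']
    · constructor
      · refine ae_of_all _ fun u => ?_
        simp_rw [← mul_assoc]
        refine Integrable.mul_const ?_ _
        have h1 : MellinConvergent (fun y : ℝ => Complex.exp (-(y : ℂ))) w := by
          have := Complex.GammaIntegral_convergent hw
          refine this.congr (ae_of_all _ fun y => ?_)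
          simp [mul_comm]
        rw [← MellinConvergent.comp_mul_left (Real.cosh_pos u)] at h1
        refine Integrable.congr h1 (ae_of_all _ fun y => ?_)
        simp [mul_comm]
      · refine (hi.norm.const_mul (Real.Gamma w.re)).congr (ae_of_all _ fun u => ?_)
        have hreal : ∫ y in Set.Ioi (0 : ℝ), y ^ (w.re - 1) * Real.exp (-(Real.cosh u * y)) =
            (1 / Real.cosh u) ^ w.re * Real.Gamma w.re :=
          Real.integral_rpow_mul_exp_neg_mul_Ioi hw (Real.cosh_pos u)
        have h2 : ∫ y in Set.Ioi (0 : ℝ), ‖(y : ℂ) ^ (w - 1) *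
            (Complex.exp (-(y : ℂ) * Real.cosh u) * Complex.cosh (μ * u))‖ =
            ∫ y in Set.Ioi (0 : ℝ), y ^ (w.re - 1) * Real.exp (-(Real.cosh u * y)) *
              ‖Complex.cosh (μ * u)‖ := by
          refine setIntegral_congr_fun measurableSet_Ioi fun y hy => ?_
          have h4 : ((-(y : ℂ)) * (Real.cosh u : ℂ)).re = -(Real.cosh u * y) := by
            rw [← Complex.ofReal_neg, ← Complex.ofReal_mul, Complex.ofReal_re]; ring
          simp only [norm_mul, Complex.norm_cpow_eq_rpow_re_of_pos hy, Complex.norm_exp, h4,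
            Complex.sub_re, Complex.one_re, mul_assoc]
        simp only [h2]
        rw [integral_mul_const, hreal, norm_mul,
          Complex.norm_cpow_eq_rpow_re_of_pos (Real.cosh_pos u), one_div,
          Real.inv_rpow (Real.cosh_pos u).le, Complex.neg_re, Real.rpow_neg (Real.cosh_pos u).le]
        ring
    · refine Measurable.aestronglyMeasurable ?_
      fun_prop
  constructor
  · refine hprod.integral_prod_left.congr (ae_of_all _ fun y => ?_)
    simp only [smul_eq_mul, besselK]
    rw [integral_const_mul]
  · rw [mellin]
    simp only [smul_eq_mul, besselK]
    simp_rw [← integral_const_mul]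
    rw [integral_integral_swap hprod]
    simp_rw [hinner]
    rw [integral_const_mul, hv]
    field_simp

/-- The `k`-th term of the power series of the modified Bessel function `I_ν`. -/
noncomputable def besselITerm (ν : ℂ) (k : ℕ) (x : ℝ) : ℂ :=
  ((x : ℂ) / 2) ^ (ν + 2 * (k : ℂ)) / ((Nat.factorial k : ℂ) * Complex.Gamma (ν + (k : ℂ) + 1))

theorem besselI_eq_tsum (ν : ℂ) (x : ℝ) : besselI ν x = ∑' k, besselITerm ν k x := rfl

theorem besselITerm_ofReal (α : ℝ) (k : ℕ) {x : ℝ} (hx : 0 < x) :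
    besselITerm α k x =
      (((x / 2) ^ (α + 2 * k) / (k.factorial * Real.Gamma (α + k + 1)) : ℝ) : ℂ) := by
  rw [besselITerm]
  push_cast [← Complex.Gamma_ofReal, Complex.ofReal_cpow (half_pos hx).le]
  rfl

theorem norm_besselITerm_ofReal {α : ℝ} (hα : -1 / 2 ≤ α) (k : ℕ) {x : ℝ} (hx : 0 < x) :
    ‖besselITerm α k x‖ = (x / 2) ^ (α + 2 * k) / (k.factorial * Real.Gamma (α + k + 1)) := by
  have : 0 < Real.Gamma (α + k + 1) :=
    Real.Gamma_pos_of_pos (by have : (0 : ℝ) ≤ k := by positivity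
                              linarith)
  rw [besselITerm_ofReal α k hx, Complex.norm_real, Real.norm_of_nonneg (by positivity)]

theorem norm_besselITerm_le {ν : ℂ} (hν : -1 / 2 ≤ ν.re) (k : ℕ) {x : ℝ} (hx : 0 < x) :
    ‖besselITerm ν k x‖ ≤ √(Real.cosh (Real.pi * ν.im)) * ‖besselITerm (ν.re : ℂ) k x‖ := by
  have hk : (0 : ℝ) ≤ k := by positivity
  have hG := inv_norm_Gamma_le (a := ν.re + k + 1) (by linarith) ν.im
  rw [show ((ν.re + k + 1 : ℝ) : ℂ) + ν.im * Complex.I = ν + k + 1 by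
    conv_rhs => rw [← Complex.re_add_im ν]
    push_cast
    ring] at hG
  have hx2 : (x : ℂ) / 2 = ((x / 2 : ℝ) : ℂ) := by push_cast; rfl
  rw [norm_besselITerm_ofReal hν k hx, besselITerm, norm_div, norm_mul, hx2,
    Complex.norm_cpow_eq_rpow_re_of_pos (half_pos hx), Complex.norm_natCast]
  have e : (ν + 2 * (k : ℂ)).re = ν.re + 2 * k := by simp
  rw [e, div_eq_mul_inv (_ ^ _), mul_inv]
  calc _ ≤ (x / 2) ^ (ν.re + 2 * (k : ℝ)) * ((k.factorial : ℝ)⁻¹ *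
        (√(Real.cosh (Real.pi * ν.im)) * (Real.Gamma (ν.re + k + 1))⁻¹)) := by gcongr
    _ = _ := by
      rw [div_eq_mul_inv (_ ^ _), mul_inv]
      ring

theorem summable_norm_besselITerm {ν : ℂ} (hν : -1 / 2 ≤ ν.re) {x : ℝ} (hx : 0 < x) :
    Summable fun k => ‖besselITerm ν k x‖ := by
  suffices h : Summable fun k => ‖besselITerm (ν.re : ℂ) k x‖ from
    Summable.of_nonneg_of_le (fun _ => norm_nonneg _) (fun k => norm_besselITerm_le hν k hx)
      (h.mul_left _)
  have hG0 : 0 < Real.Gamma (ν.re + 1) := Real.Gamma_pos_of_pos (by linarith)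
  have hG : ∀ k : ℕ, Real.Gamma (ν.re + 1) * (1 / 2) ^ k ≤ Real.Gamma (ν.re + k + 1) := by
    intro k
    induction k with
    | zero => simp
    | succ k ih =>
      have hk : (0 : ℝ) ≤ k := by positivity
      have hp : 0 < Real.Gamma (ν.re + k + 1) := Real.Gamma_pos_of_pos (by linarith)
      have e : Real.Gamma (ν.re + ((k + 1 : ℕ) : ℝ) + 1) =
          (ν.re + k + 1) * Real.Gamma (ν.re + k + 1) := by
        rw [show ν.re + ((k + 1 : ℕ) : ℝ) + 1 = (ν.re + k + 1) + 1 by push_cast; ring]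
        exact Real.Gamma_add_one (by linarith : (0 : ℝ) < _).ne'
      rw [e, pow_succ]
      nlinarith
  have h := (Real.summable_pow_div_factorial (2 * (x / 2) ^ 2)).mul_left
    ((x / 2) ^ ν.re / Real.Gamma (ν.re + 1))
  refine Summable.of_nonneg_of_le (fun _ => norm_nonneg _) (fun k => ?_) h
  rw [norm_besselITerm_ofReal hν k hx, Real.rpow_add (half_pos hx),
    show (2 : ℝ) * (k : ℝ) = ((2 * k : ℕ) : ℝ) by push_cast; rfl, Real.rpow_natCast, pow_mul,
    mul_pow]
  calc _ ≤ (x / 2) ^ ν.re * ((x / 2) ^ 2) ^ k /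
        (k.factorial * (Real.Gamma (ν.re + 1) * (1 / 2) ^ k)) := by
        gcongr
        exact hG k
    _ = _ := by
      rw [one_div, inv_pow]
      field_simp

theorem norm_besselI_le {ν : ℂ} (hν : -1 / 2 ≤ ν.re) {x : ℝ} (hx : 0 < x) :
    ‖besselI ν x‖ ≤ √(Real.cosh (Real.pi * ν.im)) * ‖besselI (ν.re : ℂ) x‖ := by
  have hs := summable_norm_besselITerm (ν := (ν.re : ℂ)) (by simpa using hν) hx
  have e : ‖besselI (ν.re : ℂ) x‖ = ∑' k, ‖besselITerm (ν.re : ℂ) k x‖ := by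
    have h1 : ∀ k, besselITerm (ν.re : ℂ) k x = ((‖besselITerm (ν.re : ℂ) k x‖ : ℝ) : ℂ) := by
      intro k
      rw [norm_besselITerm_ofReal hν k hx, besselITerm_ofReal _ _ hx]
    rw [besselI_eq_tsum, tsum_congr h1, ← Complex.ofReal_tsum, Complex.norm_real,
      Real.norm_of_nonneg (tsum_nonneg fun _ => norm_nonneg _)]
  rw [e, ← tsum_mul_left, besselI_eq_tsum]
  exact tsum_of_norm_bounded (hs.mul_left _).hasSum fun k => norm_besselITerm_le hν k hx

theorem integral_besselK_mul_besselITerm {μ ν s : ℂ} (h : |μ.re| < 2 * s.re + ν.re) (k : ℕ) :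
    IntegrableOn (fun y : ℝ => (y : ℂ) ^ (2 * s - 1) * (besselK μ y * besselITerm ν k y))
      (Set.Ioi 0) ∧
    ∫ y in Set.Ioi (0 : ℝ), (y : ℂ) ^ (2 * s - 1) * (besselK μ y * besselITerm ν k y) =
      2 ^ (2 * s - 2) * (Complex.Gamma (s + (ν + μ) / 2 + k) * Complex.Gamma (s + (ν - μ) / 2 + k) /
        ((k.factorial : ℂ) * Complex.Gamma (ν + 1 + k))) := by
  have hk : (0 : ℝ) ≤ k := by positivity
  obtain ⟨hi, hv⟩ := hasMellin_besselK (μ := μ) (w := 2 * s + ν + 2 * k) (by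
    simp
    linarith)
  have e : Set.EqOn (fun y : ℝ => ((2 : ℂ) ^ (-(ν + 2 * k)) /
      ((k.factorial : ℂ) * Complex.Gamma (ν + k + 1))) *
      ((y : ℂ) ^ (2 * s + ν + 2 * k - 1) • besselK μ y))
      (fun y : ℝ => (y : ℂ) ^ (2 * s - 1) * (besselK μ y * besselITerm ν k y)) (Set.Ioi 0) := by
    intro y hy
    have hy0 : (y : ℂ) ≠ 0 := by exact_mod_cast (ne_of_gt hy)
    have hy1 : (0 : ℝ) ≤ y := le_of_lt hy
    have h2 : (2 : ℂ) = ((2 : ℝ) : ℂ) := by norm_num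
    simp only [besselITerm, smul_eq_mul]
    rw [show 2 * s + ν + 2 * k - 1 = (2 * s - 1) + (ν + 2 * k) by ring, Complex.cpow_add _ _ hy0,
      div_eq_mul_inv (y : ℂ) 2, h2, ← Complex.ofReal_inv,
      Complex.mul_cpow_ofReal_nonneg hy1 (by norm_num), Complex.ofReal_inv, ← h2,
      Complex.inv_cpow _ _ (by rw [h2, Complex.arg_ofReal_of_nonneg (by norm_num)]
                               exact Real.pi_pos.ne), ← Complex.cpow_neg]
    ring
  constructor
  · exact (integrableOn_congr_fun e measurableSet_Ioi).1 (Integrable.const_mul hi _)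
  · rw [← setIntegral_congr_fun measurableSet_Ioi e, integral_const_mul, ← mellin, hv,
      show (2 * s + ν + 2 * k + μ) / 2 = s + (ν + μ) / 2 + k by ring,
      show (2 * s + ν + 2 * k - μ) / 2 = s + (ν - μ) / 2 + k by ring,
      show 2 * s + ν + 2 * k - 2 = (2 * s - 2) + (ν + 2 * k) by ring,
      Complex.cpow_add _ _ two_ne_zero, Complex.cpow_neg, add_right_comm ν]
    have : (2 : ℂ) ^ (ν + 2 * (k : ℂ)) ≠ 0 := by simp [Complex.cpow_eq_zero_iff]
    field_simp

theorem norm_cpow_mul_besselK_mul_besselITerm_le {ν : ℂ} (hν : -1 / 2 ≤ ν.re) (μ s : ℂ) (k : ℕ)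
    {y : ℝ} (hy : 0 < y) :
    ‖(y : ℂ) ^ (2 * s - 1) * (besselK μ y * besselITerm ν k y)‖ ≤
      √(Real.cosh (Real.pi * ν.im)) * ‖(y : ℂ) ^ (2 * (s.re : ℂ) - 1) *
        (besselK (μ.re : ℂ) y * besselITerm (ν.re : ℂ) k y)‖ := by
  rw [norm_mul, norm_mul, norm_mul, norm_mul, Complex.norm_cpow_eq_rpow_re_of_pos hy,
    Complex.norm_cpow_eq_rpow_re_of_pos hy]
  have e : (2 * (s.re : ℂ) - 1).re = (2 * s - 1).re := by simp
  rw [e]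
  have h1 := norm_besselK_le μ hy
  have h2 := norm_besselITerm_le hν k hy
  calc _ ≤ y ^ (2 * s - 1).re * (‖besselK (μ.re : ℂ) y‖ *
        (√(Real.cosh (Real.pi * ν.im)) * ‖besselITerm (ν.re : ℂ) k y‖)) := by gcongr
    _ = _ := by ring

theorem summable_integral_norm_besselK_mul_besselITerm {μ ν s : ℂ}
    (h : |μ.re| < 2 * s.re + ν.re) (hs : s.re < 1 / 2) (hν : -1 / 2 ≤ ν.re) :
    Summable fun k : ℕ => ∫ y in Set.Ioi (0 : ℝ),
      ‖(y : ℂ) ^ (2 * s - 1) * (besselK μ y * besselITerm ν k y)‖ := by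
  obtain ⟨h1, h2⟩ := abs_lt.1 h
  have hr : |(μ.re : ℂ).re| < 2 * (s.re : ℂ).re + (ν.re : ℂ).re := by simpa using h
  have key : Summable fun k : ℕ => ∫ y in Set.Ioi (0 : ℝ),
      ‖(y : ℂ) ^ (2 * (s.re : ℂ) - 1) * (besselK (μ.re : ℂ) y * besselITerm (ν.re : ℂ) k y)‖ := by
    have hg := (hasSum_gauss (a := s.re + ((ν.re : ℂ) + μ.re) / 2)
      (b := s.re + ((ν.re : ℂ) - μ.re) / 2) (c := ν.re + 1) (by simp; linarith) (by simp; linarith)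
      (by simp; linarith)).summable.mul_left (2 ^ (2 * (s.re : ℂ) - 2))
    rw [← Complex.summable_ofReal]
    refine hg.congr fun k => ?_
    rw [← (integral_besselK_mul_besselITerm hr k).2, ← integral_complex_ofReal]
    refine setIntegral_congr_fun measurableSet_Ioi fun y hy => ?_
    have hy : 0 < y := hy
    have hb := norm_besselITerm_ofReal hν k hy
    have hK : besselK (μ.re : ℂ) y = (‖besselK (μ.re : ℂ) y‖ : ℂ) := by
      rw [besselK_ofReal, Complex.norm_real, Real.norm_of_nonneg (by positivity)]
    have hI : besselITerm (ν.re : ℂ) k y = (‖besselITerm (ν.re : ℂ) k y‖ : ℂ) := by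
      rw [hb, besselITerm_ofReal _ _ hy]
    have hp : (y : ℂ) ^ (2 * (s.re : ℂ) - 1) = (‖(y : ℂ) ^ (2 * (s.re : ℂ) - 1)‖ : ℂ) := by
      rw [Complex.norm_cpow_eq_rpow_re_of_pos hy, Complex.ofReal_cpow hy.le]
      simp
    simp only [norm_mul, Complex.ofReal_mul]
    rw [← hp, ← hK, ← hI]
  refine Summable.of_nonneg_of_le (fun k => integral_nonneg fun _ => norm_nonneg _) (fun k => ?_)
    (key.mul_left √(Real.cosh (Real.pi * ν.im)))
  rw [← integral_const_mul]
  refine setIntegral_mono_on (integral_besselK_mul_besselITerm h k).1.norm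
    ((integral_besselK_mul_besselITerm hr k).1.norm.const_mul _) measurableSet_Ioi fun y hy => ?_
  exact norm_cpow_mul_besselK_mul_besselITerm_le hν μ s k hy

/-- The Mellin transform of the product `K_μ I_ν`. -/
theorem mellin_besselK_mul_besselI {μ ν s : ℂ}
    (h : |μ.re| < 2 * s.re + ν.re) (hs : s.re < 1 / 2) (hν : -1 / 2 ≤ ν.re) :
    mellin (fun y => besselK μ y * besselI ν y) (2 * s) =
      2 ^ (2 * s - 2) * (Complex.Gamma (s + (ν + μ) / 2) * Complex.Gamma (s + (ν - μ) / 2) *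
        Complex.Gamma (1 - 2 * s) /
        (Complex.Gamma (1 - s + (ν - μ) / 2) * Complex.Gamma (1 - s + (ν + μ) / 2))) := by
  obtain ⟨h1, h2⟩ := abs_lt.1 h
  have hg := (hasSum_gauss (a := s + (ν + μ) / 2) (b := s + (ν - μ) / 2) (c := ν + 1)
    (by simp; linarith) (by simp; linarith) (by simp; linarith)).mul_left (2 ^ (2 * s - 2))
  have hsum := hasSum_integral_of_summable_integral_norm
    (fun k => (integral_besselK_mul_besselITerm h k).1)
    (summable_integral_norm_besselK_mul_besselITerm h hs hν)
  simp_rw [(integral_besselK_mul_besselITerm h _).2] at hsum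
  have := hsum.unique hg
  simp_rw [tsum_mul_left, ← besselI_eq_tsum] at this
  rw [show ν + 1 - (s + (ν + μ) / 2) - (s + (ν - μ) / 2) = 1 - 2 * s by ring,
    show ν + 1 - (s + (ν + μ) / 2) = 1 - s + (ν - μ) / 2 by ring,
    show ν + 1 - (s + (ν - μ) / 2) = 1 - s + (ν + μ) / 2 by ring] at this
  rw [mellin]
  simp_rw [smul_eq_mul]
  exact this

theorem aestronglyMeasurable_of_hasSum_ae {β : Type*} [MeasurableSpace β] {m : Measure β}
    {F : ℕ → β → ℂ} {f : β → ℂ} (hF : ∀ k, AEStronglyMeasurable (F k) m)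
    (h : ∀ᵐ b ∂m, HasSum (fun k => F k b) (f b)) : AEStronglyMeasurable f m := by
  refine aestronglyMeasurable_of_tendsto_ae atTop
    (f := fun (n : ℕ) b => ∑ k ∈ Finset.range n, F k b) (fun n => ?_) ?_
  · exact Finset.aestronglyMeasurable_fun_sum _ fun k _ => hF k
  · filter_upwards [h] with b hb
    exact hb.tendsto_sum_nat

theorem norm_besselK_mul_besselI_le {μ ν : ℂ} (hν : -1 / 2 ≤ ν.re) {y : ℝ} (hy : 0 < y) :
    ‖besselK μ y * besselI ν y‖ ≤ √(Real.cosh (Real.pi * ν.im)) *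
      ‖besselK (μ.re : ℂ) y * besselI (ν.re : ℂ) y‖ := by
  rw [norm_mul, norm_mul, mul_left_comm]
  have h1 := norm_besselK_le μ hy
  have h2 := norm_besselI_le hν hy
  gcongr

theorem mellinConvergent_besselK_mul_besselI {μ ν s : ℂ}
    (h : |μ.re| < 2 * s.re + ν.re) (hs : s.re < 1 / 2) (hν : -1 / 2 ≤ ν.re) :
    MellinConvergent (fun y => besselK μ y * besselI ν y) (2 * s) := by
  obtain ⟨h1, h2⟩ := abs_lt.1 h
  have hr : |(μ.re : ℂ).re| < 2 * (s.re : ℂ).re + (ν.re : ℂ).re := by simpa using h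
  have hreal : MellinConvergent (fun y => besselK (μ.re : ℂ) y * besselI (ν.re : ℂ) y)
      (2 * (s.re : ℂ)) := by
    refine Integrable.of_integral_ne_zero ?_
    rw [← mellin, mellin_besselK_mul_besselI hr (by simpa using hs) (by simpa using hν)]
    have hG : ∀ z : ℂ, 0 < z.re → Complex.Gamma z ≠ 0 := fun z hz =>
      Complex.Gamma_ne_zero_of_re_pos hz
    refine mul_ne_zero (by simp [Complex.cpow_eq_zero_iff]) (div_ne_zero (mul_ne_zero
      (mul_ne_zero (hG _ ?_) (hG _ ?_)) (hG _ ?_)) (mul_ne_zero (hG _ ?_) (hG _ ?_)))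
    all_goals simp; linarith
  refine (hreal.norm.const_mul √(Real.cosh (Real.pi * ν.im))).mono' ?_ ?_
  · simp only [smul_eq_mul]
    refine aestronglyMeasurable_of_hasSum_ae
      (fun k => (integral_besselK_mul_besselITerm h k).1.aestronglyMeasurable) ?_
    filter_upwards [ae_restrict_mem measurableSet_Ioi] with y hy
    exact ((summable_norm_besselITerm hν hy).of_norm.hasSum.mul_left _).mul_left _
  · filter_upwards [ae_restrict_mem measurableSet_Ioi] with y hy
    have hy : 0 < y := hy
    have e : (2 * (s.re : ℂ) - 1).re = (2 * s - 1).re := by simp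
    rw [norm_smul, norm_smul, Complex.norm_cpow_eq_rpow_re_of_pos hy,
      Complex.norm_cpow_eq_rpow_re_of_pos hy, e, mul_left_comm]
    have := norm_besselK_mul_besselI_le (μ := μ) hν hy
    gcongr

theorem besselK_conj (μ : ℂ) (y : ℝ) :
    besselK ((starRingEnd ℂ) μ) y = (starRingEnd ℂ) (besselK μ y) := by
  rw [besselK, besselK, ← integral_conj]
  congr 1
  ext t
  simp [← Complex.exp_conj, ← Complex.cosh_conj]

theorem besselI_conj (ν : ℂ) {y : ℝ} (hy : 0 < y) :
    besselI ((starRingEnd ℂ) ν) y = (starRingEnd ℂ) (besselI ν y) := by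
  rw [besselI_eq_tsum, besselI_eq_tsum, Complex.conj_tsum]
  refine tsum_congr fun k => ?_
  have hy2 : (y : ℂ) / 2 = ((y / 2 : ℝ) : ℂ) := by push_cast; rfl
  have harg : ((y / 2 : ℝ) : ℂ).arg ≠ Real.pi := by
    rw [Complex.arg_ofReal_of_nonneg (half_pos hy).le]
    exact Real.pi_pos.ne
  have h := Complex.cpow_conj ((y / 2 : ℝ) : ℂ) (ν + 2 * k) harg
  rw [Complex.conj_ofReal] at h
  simp only [besselITerm, hy2, map_div₀, map_mul, map_natCast, ← Complex.Gamma_conj, ← h, map_add,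
    map_one, Complex.conj_ofNat]

/-- The real-valued kernel `Re[K_{α+iτ}(y) I_{α-iτ}(y)]`. -/
noncomputable def besselKernel (α τ y : ℝ) : ℝ :=
  (besselK (α + τ * Complex.I) y * besselI (α - τ * Complex.I) y).re

theorem ofReal_besselKernel (α τ : ℝ) {y : ℝ} (hy : 0 < y) :
    (besselKernel α τ y : ℂ) =
      (1 / 2 : ℂ) • (besselK (α + τ * Complex.I) y * besselI (α - τ * Complex.I) y +
        besselK (α - τ * Complex.I) y * besselI (α + τ * Complex.I) y) := by
  rw [besselKernel, Complex.re_eq_add_conj, map_mul, ← besselK_conj, ← besselI_conj _ hy]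
  simp only [map_add, map_sub, map_mul, Complex.conj_ofReal, Complex.conj_I, smul_eq_mul]
  rw [mul_neg, sub_neg_eq_add, ← sub_eq_add_neg]
  ring

theorem inv_Gamma_one_sub {z : ℂ} (h0 : 0 < z.re) (h1 : z.re < 1) :
    (Complex.Gamma (1 - z))⁻¹ = Complex.Gamma z * Complex.sin (Real.pi * z) / Real.pi := by
  have h := Complex.Gamma_mul_Gamma_one_sub z
  have hz := Complex.Gamma_ne_zero_of_re_pos h0
  have hz1 : Complex.Gamma (1 - z) ≠ 0 := Complex.Gamma_ne_zero_of_re_pos (by simpa using h1)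
  have hs : Complex.sin (Real.pi * z) ≠ 0 := by
    intro hs
    rw [hs, div_zero] at h
    exact mul_ne_zero hz hz1 h
  have hpi : (Real.pi : ℂ) ≠ 0 := by exact_mod_cast Real.pi_ne_zero
  rw [eq_div_iff hs] at h
  rw [eq_div_iff hpi, inv_mul_eq_iff_eq_mul₀ hz1]
  linear_combination -h

theorem Gamma_div_add_Gamma_div {s : ℂ} (h0 : 0 < s.re) (h1 : s.re < 1) (τ : ℝ) :
    Complex.Gamma (s - τ * Complex.I) / Complex.Gamma (1 - s - τ * Complex.I) +
      Complex.Gamma (s + τ * Complex.I) / Complex.Gamma (1 - s + τ * Complex.I) =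
    2 * (Complex.Gamma (s + τ * Complex.I) * Complex.Gamma (s - τ * Complex.I)) *
      Real.cosh (Real.pi * τ) / (Complex.Gamma s * Complex.Gamma (1 - s)) := by
  have e1 := inv_Gamma_one_sub (z := s + τ * Complex.I) (by simpa using h0) (by simpa using h1)
  have e2 := inv_Gamma_one_sub (z := s - τ * Complex.I) (by simpa using h0) (by simpa using h1)
  have e3 := inv_Gamma_one_sub h0 h1
  have hs := Complex.Gamma_ne_zero_of_re_pos h0
  have hsin := Complex.sin_add_sin (Real.pi * (s + τ * Complex.I)) (Real.pi * (s - τ * Complex.I))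
  rw [show ((Real.pi : ℂ) * (s + τ * Complex.I) + Real.pi * (s - τ * Complex.I)) / 2 =
      Real.pi * s by ring, show ((Real.pi : ℂ) * (s + τ * Complex.I) -
      Real.pi * (s - τ * Complex.I)) / 2 = (Real.pi * τ) * Complex.I by ring,
    Complex.cos_mul_I] at hsin
  rw [show 1 - s - τ * Complex.I = 1 - (s + τ * Complex.I) by ring,
    show 1 - s + τ * Complex.I = 1 - (s - τ * Complex.I) by ring, div_eq_mul_inv _ (_ * _), mul_inv,
    e3, div_eq_mul_inv, e1, div_eq_mul_inv (Complex.Gamma (s + _)), e2]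
  push_cast
  calc _ = Complex.Gamma (s + τ * Complex.I) * Complex.Gamma (s - τ * Complex.I) *
        (Complex.sin (Real.pi * (s + τ * Complex.I)) +
          Complex.sin (Real.pi * (s - τ * Complex.I))) / Real.pi := by ring
    _ = _ := by
      rw [hsin]
      field_simp

theorem Gamma_one_sub_two_mul (s : ℂ) :
    Complex.Gamma (1 / 2 - s) * Complex.Gamma (1 - s) =
      Complex.Gamma (1 - 2 * s) * 2 ^ (2 * s) * √Real.pi := by
  have h := Complex.Gamma_mul_Gamma_add_half (1 / 2 - s)
  rwa [show 1 / 2 - s + 1 / 2 = 1 - s by ring, show 2 * (1 / 2 - s) = 1 - 2 * s by ring,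
    show 1 - (1 - 2 * s) = 2 * s by ring] at h

theorem hasMellin_besselKernel {α : ℝ} {s : ℂ} (hα : -1 / 2 ≤ α) (h0 : 0 < s.re)
    (h1 : s.re < 1 / 2) (hs : 0 < s.re + α) (τ : ℝ) :
    HasMellin (fun y => (besselKernel α τ y : ℂ)) (2 * s)
      ((4 * √Real.pi : ℂ)⁻¹ * (Complex.Gamma (s + α) * Complex.Gamma (1 / 2 - s) /
        (Complex.Gamma s * Complex.Gamma (1 + α - s))) *
        (Complex.Gamma (s + τ * Complex.I) * Complex.Gamma (s - τ * Complex.I)) *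
        Real.cosh (Real.pi * τ)) := by
  have habs : |α| < 2 * s.re + α := abs_lt.2 ⟨by linarith, by linarith⟩
  have c1 := mellinConvergent_besselK_mul_besselI (μ := α + τ * Complex.I)
    (ν := α - τ * Complex.I) (s := s) (by simpa using habs) h1 (by simpa using hα)
  have c2 := mellinConvergent_besselK_mul_besselI (μ := α - τ * Complex.I)
    (ν := α + τ * Complex.I) (s := s) (by simpa using habs) h1 (by simpa using hα)
  have m1 := mellin_besselK_mul_besselI (μ := α + τ * Complex.I)
    (ν := α - τ * Complex.I) (s := s) (by simpa using habs) h1 (by simpa using hα)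
  have m2 := mellin_besselK_mul_besselI (μ := α - τ * Complex.I)
    (ν := α + τ * Complex.I) (s := s) (by simpa using habs) h1 (by simpa using hα)
  obtain ⟨c, m⟩ := hasMellin_add c1 c2
  have hc := c.const_smul (1 / 2 : ℂ)
  have e : Set.EqOn (fun y : ℝ => (y : ℂ) ^ (2 * s - 1) •
      ((1 / 2 : ℂ) • (besselK (α + τ * Complex.I) y * besselI (α - τ * Complex.I) y +
        besselK (α - τ * Complex.I) y * besselI (α + τ * Complex.I) y)))
      (fun y : ℝ => (y : ℂ) ^ (2 * s - 1) • (besselKernel α τ y : ℂ)) (Set.Ioi 0) := by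
    intro y hy
    simp only [ofReal_besselKernel α τ hy]
  refine ⟨(integrableOn_congr_fun e measurableSet_Ioi).1 hc, ?_⟩
  rw [mellin, ← setIntegral_congr_fun measurableSet_Ioi e, ← mellin, mellin_const_smul, m, m1, m2]
  have p1 : ((α : ℂ) - τ * Complex.I + (α + τ * Complex.I)) / 2 = α := by ring
  have p2 : ((α : ℂ) - τ * Complex.I - (α + τ * Complex.I)) / 2 = -(τ * Complex.I) := by ring
  have p3 : ((α : ℂ) + τ * Complex.I + (α - τ * Complex.I)) / 2 = α := by ring
  have p4 : ((α : ℂ) + τ * Complex.I - (α - τ * Complex.I)) / 2 = τ * Complex.I := by ring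
  rw [p1, p2, p3, p4, ← sub_eq_add_neg, ← sub_eq_add_neg, show 1 - s + (α : ℂ) = 1 + α - s by ring,
    smul_eq_mul]
  have hsum := Gamma_div_add_Gamma_div h0 (h1.trans (by norm_num)) τ
  have hdup := Gamma_one_sub_two_mul s
  have hsp : (√Real.pi : ℂ) ≠ 0 := by
    exact_mod_cast (Real.sqrt_pos.2 Real.pi_pos).ne'
  have h1s : Complex.Gamma (1 - s) ≠ 0 :=
    Complex.Gamma_ne_zero_of_re_pos (by simp; linarith)
  have hs0 : Complex.Gamma s ≠ 0 := Complex.Gamma_ne_zero_of_re_pos h0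
  have h2 : (2 : ℂ) ^ (2 * s - 2) = 2 ^ (2 * s) / 4 := by
    rw [Complex.cpow_sub _ _ two_ne_zero]
    norm_num
  calc _ = (1 / 2) * 2 ^ (2 * s - 2) * Complex.Gamma (1 - 2 * s) *
        (Complex.Gamma (s + α) / Complex.Gamma (1 + α - s)) *
        (Complex.Gamma (s - τ * Complex.I) / Complex.Gamma (1 - s - τ * Complex.I) +
          Complex.Gamma (s + τ * Complex.I) / Complex.Gamma (1 - s + τ * Complex.I)) := by
        ring
    _ = (Complex.Gamma (1 - 2 * s) * 2 ^ (2 * s) * √Real.pi) *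
        (Complex.Gamma (s + α) / Complex.Gamma (1 + α - s)) *
        (Complex.Gamma (s + τ * Complex.I) * Complex.Gamma (s - τ * Complex.I)) *
        Real.cosh (Real.pi * τ) / (4 * √Real.pi * Complex.Gamma s * Complex.Gamma (1 - s)) := by
        rw [hsum, h2]
        field_simp
    _ = _ := by
        rw [← hdup]
        field_simp

theorem norm_besselKernel_le {α : ℝ} (hα : -1 / 2 ≤ α) (τ : ℝ) {y : ℝ} (hy : 0 < y) :
    ‖besselKernel α τ y‖ ≤ Real.cosh (Real.pi * τ) * ‖besselK α y * besselI α y‖ := by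
  have h := norm_besselK_mul_besselI_le (μ := α + τ * Complex.I) (ν := α - τ * Complex.I)
    (by simpa using hα) hy
  have hc := Real.one_le_cosh (Real.pi * τ)
  have hsq : √(Real.cosh (Real.pi * τ)) ≤ Real.cosh (Real.pi * τ) := by
    rw [Real.sqrt_le_left (by linarith)]
    nlinarith
  calc _ ≤ ‖besselK (α + τ * Complex.I) y * besselI (α - τ * Complex.I) y‖ :=
        Complex.abs_re_le_norm _
    _ ≤ √(Real.cosh (Real.pi * τ)) * ‖besselK α y * besselI α y‖ := by simpa using h
    _ ≤ _ := by gcongr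

theorem aestronglyMeasurable_besselKernel {α : ℝ} (hα : -1 / 2 ≤ α) :
    AEStronglyMeasurable (fun p : ℝ × ℝ => besselKernel α p.2 √p.1)
      ((volume.restrict (Set.Ioi 0)).prod volume) := by
  have hK : StronglyMeasurable fun p : ℝ × ℝ => besselK (α + p.2 * Complex.I) √p.1 := by
    unfold besselK
    refine StronglyMeasurable.integral_prod_right (Continuous.stronglyMeasurable ?_)
    unfold Function.uncurry
    fun_prop
  have hI : AEStronglyMeasurable (fun p : ℝ × ℝ => besselI (α - p.2 * Complex.I) √p.1)
      ((volume.restrict (Set.Ioi 0)).prod volume) := by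
    refine aestronglyMeasurable_of_hasSum_ae
      (F := fun k (p : ℝ × ℝ) => besselITerm (α - p.2 * Complex.I) k √p.1) (fun k => ?_) ?_
    · refine Measurable.aestronglyMeasurable ?_
      unfold besselITerm
      have hΓ : Measurable fun p : ℝ × ℝ => Complex.Gamma (α - p.2 * Complex.I + k + 1) := by
        have := (Complex.differentiable_one_div_Gamma.continuous.measurable.inv).comp
          (show Measurable fun p : ℝ × ℝ => (α : ℂ) - p.2 * Complex.I + k + 1 by fun_prop)
        simpa [Function.comp_def] using this
      exact (Measurable.pow (by fun_prop) (by fun_prop)).div (hΓ.const_mul _)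
    · have hmem : ∀ᵐ p : ℝ × ℝ ∂(volume.restrict (Set.Ioi (0 : ℝ))).prod volume,
          p.1 ∈ Set.Ioi (0 : ℝ) :=
        Measure.quasiMeasurePreserving_fst.ae (ae_restrict_mem measurableSet_Ioi)
      filter_upwards [hmem] with p hp
      exact (summable_norm_besselITerm (by simpa using hα)
        (Real.sqrt_pos.2 hp)).of_norm.hasSum
  exact (hK.aestronglyMeasurable.mul hI).re

theorem integrable_cpow_mul_besselKernel {α : ℝ} {s : ℂ} {g : ℝ → ℝ} (hg : Integrable g)
    (hα : -1 / 2 ≤ α) (h0 : 0 < s.re) (h1 : s.re < 1 / 2) (hs : 0 < s.re + α) :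
    Integrable (Function.uncurry fun x τ : ℝ => (x : ℂ) ^ (s - 1) *
      ((besselKernel α τ √x * g τ / Real.cosh (Real.pi * τ) : ℝ) : ℂ))
      ((volume.restrict (Set.Ioi 0)).prod volume) := by
  have habs : |α| < 2 * s.re + α := abs_lt.2 ⟨by linarith, by linarith⟩
  have c := mellinConvergent_besselK_mul_besselI (μ := α) (ν := α) (s := s) (by simpa using habs)
    h1 (by simpa using hα)
  have hc : MellinConvergent (fun x => besselK α (x ^ (1 / 2 : ℝ)) * besselI α (x ^ (1 / 2 : ℝ))) s :=
    (MellinConvergent.comp_rpow (f := fun y => besselK α y * besselI α y)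
      (by norm_num : (1 / 2 : ℝ) ≠ 0)).2 (by
        convert c using 1
        push_cast
        ring)
  have hmem : ∀ᵐ p : ℝ × ℝ ∂(volume.restrict (Set.Ioi (0 : ℝ))).prod volume,
      p.1 ∈ Set.Ioi (0 : ℝ) :=
    Measure.quasiMeasurePreserving_fst.ae (ae_restrict_mem measurableSet_Ioi)
  refine ((Integrable.norm hc).mul_prod hg.norm).mono' ?_ ?_
  · have hm := aestronglyMeasurable_besselKernel hα
    have hpow : Measurable fun p : ℝ × ℝ => (p.1 : ℂ) ^ (s - 1) := by fun_prop
    have hcosh : Measurable fun p : ℝ × ℝ => (Real.cosh (Real.pi * p.2))⁻¹ := by fun_prop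
    exact hpow.aestronglyMeasurable.mul (Complex.continuous_ofReal.comp_aestronglyMeasurable
      ((hm.mul hg.aestronglyMeasurable.comp_snd).mul hcosh.aestronglyMeasurable))
  · filter_upwards [hmem] with p hp
    have hp : 0 < p.1 := hp
    have hk := norm_besselKernel_le hα p.2 (Real.sqrt_pos.2 hp)
    have hpos := Real.cosh_pos (Real.pi * p.2)
    simp only [Function.uncurry, ← Real.sqrt_eq_rpow]
    rw [norm_mul, norm_smul, Complex.norm_real, norm_div, norm_mul, Real.norm_of_nonneg hpos.le,
      mul_assoc]
    refine mul_le_mul_of_nonneg_left ?_ (norm_nonneg _)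
    rw [div_le_iff₀ hpos]
    calc _ ≤ _ := mul_le_mul_of_nonneg_right hk (norm_nonneg _)
      _ = _ := by ring

theorem setIntegral_cpow_mul_besselKernel_sqrt {α : ℝ} {s : ℂ} (hα : -1 / 2 ≤ α) (h0 : 0 < s.re)
    (h1 : s.re < 1 / 2) (hs : 0 < s.re + α) (τ : ℝ) :
    ∫ x in Set.Ioi (0 : ℝ), (x : ℂ) ^ (s - 1) * (besselKernel α τ √x : ℂ) =
      (2 * √Real.pi : ℂ)⁻¹ * (Complex.Gamma (s + α) * Complex.Gamma (1 / 2 - s) /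
        (Complex.Gamma s * Complex.Gamma (1 + α - s))) *
        (Complex.Gamma (s + τ * Complex.I) * Complex.Gamma (s - τ * Complex.I)) *
        Real.cosh (Real.pi * τ) := by
  have h := mellin_comp_rpow (fun y => (besselKernel α τ y : ℂ)) s (1 / 2)
  rw [show s / ((1 / 2 : ℝ) : ℂ) = 2 * s by push_cast; ring,
    (hasMellin_besselKernel hα h0 h1 hs τ).2, mellin] at h
  simp_rw [← Real.sqrt_eq_rpow, smul_eq_mul] at h
  rw [h, abs_of_pos (by norm_num), Complex.real_smul]
  push_cast
  ring

/-- Mellin transform identity in the proof of Theorem 3: for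
`α > −1/4`, `g ∈ L₁(ℝ)` and `G_α g ∈ L_{ν,1}((0,1))` with `max(−α,0) < ν < 1/2`,
for `s` with `Re s = ν` the Mellin transform of `G_α g` exists and
`[Γ(s)Γ(1+α−s)/Γ(s+α)](G_α g)*(s) = Γ(1/2−s) ∫_ℝ g(τ)Γ(s+iτ)Γ(s−iτ) dτ`. -/
theorem statement19 (α ν : ℝ) (hα : α > -1/4) (hν : max (-α) 0 < ν ∧ ν < 1/2)
    (g : ℝ → ℝ) (hmeas : MeasureTheory.AEStronglyMeasurable g MeasureTheory.volume)
    (hg : MeasureTheory.Integrable g)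
    (hGν : MeasureTheory.IntegrableOn
      (fun x : ℝ => |Gtrans α g x| * x ^ (ν - 1)) (Set.Ioo 0 1)) :
    ∀ t : ℝ,
      (fun s : ℂ =>
        MeasureTheory.IntegrableOn
          (fun x : ℝ => (Gtrans α g x : ℂ) * (x : ℂ) ^ (s - 1)) (Set.Ioi 0) ∧
        Complex.Gamma s * Complex.Gamma (1 + α - s) / Complex.Gamma (s + α) *
            mellinT (Gtrans α g) s =
          Complex.Gamma (1/2 - s) *
            ∫ τ : ℝ, (g τ : ℂ) * Complex.Gamma (s + τ * Complex.I) *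
              Complex.Gamma (s - τ * Complex.I)) ((ν : ℂ) + t * Complex.I) := by
  intro t
  obtain ⟨hν1, hν2⟩ := hν
  obtain ⟨hνα, hν0⟩ := max_lt_iff.1 hν1
  have hα' : -1 / 2 ≤ α := by linarith
  obtain ⟨s, hsdef⟩ : ∃ s : ℂ, s = (ν : ℂ) + t * Complex.I := ⟨_, rfl⟩
  have hre : s.re = ν := by simp [hsdef]
  rw [← hsdef]
  have h0 : 0 < s.re := by linarith
  have h1 : s.re < 1 / 2 := by linarith
  have hs : 0 < s.re + α := by linarith
  have hF := integrable_cpow_mul_besselKernel (s := s) hg hα' h0 h1 hs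
  have hx : ∀ x : ℝ, (Gtrans α g x : ℂ) * (x : ℂ) ^ (s - 1) =
      (2 * √Real.pi : ℂ) * ∫ τ : ℝ, (x : ℂ) ^ (s - 1) *
        ((besselKernel α τ √x * g τ / Real.cosh (Real.pi * τ) : ℝ) : ℂ) := by
    intro x
    rw [integral_const_mul, integral_complex_ofReal, Gtrans]
    simp only [besselKernel]
    push_cast
    ring
  refine ⟨?_, ?_⟩
  · simp_rw [hx]
    exact hF.integral_prod_left.const_mul _
  · have hval : ∀ τ : ℝ, ∫ x in Set.Ioi (0 : ℝ), (x : ℂ) ^ (s - 1) *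
        ((besselKernel α τ √x * g τ / Real.cosh (Real.pi * τ) : ℝ) : ℂ) =
        (2 * √Real.pi : ℂ)⁻¹ * (Complex.Gamma (s + α) * Complex.Gamma (1 / 2 - s) /
          (Complex.Gamma s * Complex.Gamma (1 + α - s))) *
          ((g τ : ℂ) * Complex.Gamma (s + τ * Complex.I) * Complex.Gamma (s - τ * Complex.I)) := by
      intro τ
      have hc : (Real.cosh (Real.pi * τ) : ℂ) ≠ 0 := by
        exact_mod_cast (Real.cosh_pos _).ne'
      have e : ∀ x : ℝ, (x : ℂ) ^ (s - 1) *
          ((besselKernel α τ √x * g τ / Real.cosh (Real.pi * τ) : ℝ) : ℂ) =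
          (x : ℂ) ^ (s - 1) * (besselKernel α τ √x : ℂ) *
            ((g τ : ℂ) / Real.cosh (Real.pi * τ)) := by
        intro x
        rw [Complex.ofReal_div, Complex.ofReal_mul]
        ring
      simp_rw [e]
      rw [integral_mul_const, setIntegral_cpow_mul_besselKernel_sqrt hα' h0 h1 hs τ]
      field_simp
    have hsp : (√Real.pi : ℂ) ≠ 0 := by exact_mod_cast (Real.sqrt_pos.2 Real.pi_pos).ne'
    have hG1 := Complex.Gamma_ne_zero_of_re_pos h0
    have hG2 : Complex.Gamma (s + α) ≠ 0 := Complex.Gamma_ne_zero_of_re_pos (by simpa using hs)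
    have hG3 : Complex.Gamma (1 + α - s) ≠ 0 :=
      Complex.Gamma_ne_zero_of_re_pos (by simp; linarith)
    rw [mellinT]
    simp_rw [hx]
    rw [integral_const_mul, integral_integral_swap hF]
    simp_rw [hval]
    rw [integral_const_mul]
    generalize (∫ τ : ℝ, (g τ : ℂ) * Complex.Gamma (s + τ * Complex.I) *
      Complex.Gamma (s - τ * Complex.I)) = J
    field_simp
end
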